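/- For every integer k ≥ 2 there exists a plane triangulation of order n = 24k such that the maximum order of an induced subgraph that is outerplane in the inherited embedding equals 5n/8 + 1 = 15k + 1; in particular, s_{o'}(G) ≤ 5n/8 + 1 < 2n/3 for these graphs. -/

import Mathlib

/-- A drawing (embedding) of a simple graph in the plane `ℝ × ℝ` without crossings:
vertices are mapped to distinct points, each edge to an injective arc joining its
endpoints, arcs pass through no other vertex, and two arcs of distinct edges meet
only in common endpoints. -/
structure PlaneEmbedding {V : Type} (G : SimpleGraph V) where
  vtx : V → ℝ × ℝ
  vtx_inj : Function.Injective vtx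
  arc : ∀ ⦃u v : V⦄, G.Adj u v → Set (ℝ × ℝ)
  arc_symm : ∀ ⦃u v : V⦄ (h : G.Adj u v), arc h.symm = arc h
  arc_path : ∀ ⦃u v : V⦄ (h : G.Adj u v),
    ∃ γ : Path (vtx u) (vtx v), Function.Injective ⇑γ ∧ Set.range ⇑γ = arc h
  arc_vtx : ∀ ⦃u v : V⦄ (h : G.Adj u v) (w : V), vtx w ∈ arc h → w = u ∨ w = v
  arc_inter : ∀ ⦃u v a b : V⦄ (h₁ : G.Adj u v) (h₂ : G.Adj a b), s(u, v) ≠ s(a, b) →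
    arc h₁ ∩ arc h₂ ⊆ ({vtx u, vtx v} : Set (ℝ × ℝ)) ∩ {vtx a, vtx b}

namespace PlaneEmbedding

variable {V : Type} {G : SimpleGraph V}

/-- The point set of the sub-drawing determined by the vertices in `S`
(the inherited embedding of the induced subgraph on `S`). -/
def subSupport (E : PlaneEmbedding G) (S : Set V) : Set (ℝ × ℝ) :=
  E.vtx '' S ∪ ⋃ (u : V) (_ : u ∈ S) (v : V) (_ : v ∈ S) (h : G.Adj u v), E.arc h

/-- The induced subgraph on `S`, with the inherited embedding, is an outerplane graph:
every vertex of `S` lies on the boundary of the outer (unbounded) face, i.e. in the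
closure of the set of points belonging to unbounded faces of the sub-drawing. -/
def OuterplaneOn (E : PlaneEmbedding G) (S : Set V) : Prop :=
  ∀ v ∈ S, E.vtx v ∈ closure {p | p ∉ E.subSupport S ∧
    ¬ Bornology.IsBounded (connectedComponentIn (E.subSupport S)ᶜ p)}

/-- The whole drawing is an outerplane graph. -/
def IsOuterplane (E : PlaneEmbedding G) : Prop := E.OuterplaneOn Set.univ

end PlaneEmbedding

/-- A graph is planar if it admits a plane embedding. -/
def IsPlanar {V : Type} (G : SimpleGraph V) : Prop := Nonempty (PlaneEmbedding G)

/-- A graph is outerplanar if it admits a plane embedding with all vertices on the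
boundary of the outer face. -/
def IsOuterplanar {V : Type} (G : SimpleGraph V) : Prop :=
  ∃ E : PlaneEmbedding G, E.IsOuterplane

/-- A plane triangulation is an edge-maximal (finite) planar graph. -/
def IsPlaneTriangulation {V : Type} (G : SimpleGraph V) : Prop :=
  IsPlanar G ∧ ∀ u v : V, u ≠ v → ¬ G.Adj u v →
    ¬ IsPlanar (G ⊔ SimpleGraph.fromEdgeSet {s(u, v)})

/-- `G` has a `K_m`-minor: there are `m` pairwise disjoint nonempty connected branch
sets with an edge between any two of them. -/
def HasCliqueMinor {V : Type} (G : SimpleGraph V) (m : ℕ) : Prop :=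
  ∃ B : Fin m → Set V,
    (∀ i, (B i).Nonempty) ∧
    (∀ i, (G.induce (B i)).Connected) ∧
    (∀ i j, i ≠ j → Disjoint (B i) (B j)) ∧
    (∀ i j, i ≠ j → ∃ u ∈ B i, ∃ v ∈ B j, G.Adj u v)

/-- `G` is `K₄`-minor free. -/
def K4MinorFree {V : Type} (G : SimpleGraph V) : Prop := ¬ HasCliqueMinor G 4

/-- `s_{o'}(G)` for a fixed plane embedding of `G`: the maximum order of an induced
subgraph whose inherited embedding is an outerplane graph. -/
noncomputable def sO' {V : Type} [Fintype V] {G : SimpleGraph V}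
    (E : PlaneEmbedding G) : ℕ :=
  sSup {n | ∃ S : Finset V, E.OuterplaneOn ↑S ∧ S.card = n}

/-- `s_o(G)`: the maximum order of an induced outerplanar subgraph of `G`. -/
noncomputable def sO {V : Type} [Fintype V] (G : SimpleGraph V) : ℕ :=
  sSup {n | ∃ S : Finset V, IsOuterplanar (G.induce (↑S : Set V)) ∧ S.card = n}

/-- `s_{K₄}(G)`: the maximum order of an induced `K₄`-minor-free subgraph of `G`. -/
noncomputable def sK4 {V : Type} [Fintype V] (G : SimpleGraph V) : ℕ :=
  sSup {n | ∃ S : Finset V, K4MinorFree (G.induce (↑S : Set V)) ∧ S.card = n}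

/-- `tw(G) ≤ k`: `G` admits a tree decomposition of width at most `k`. -/
def TreewidthLE {V : Type} (G : SimpleGraph V) (k : ℕ) : Prop :=
  ∃ (ι : Type) (T : SimpleGraph ι) (bag : ι → Set V),
    T.IsTree ∧
    (∀ v : V, ∃ i, v ∈ bag i) ∧
    (∀ u v : V, G.Adj u v → ∃ i, u ∈ bag i ∧ v ∈ bag i) ∧
    (∀ v : V, (T.induce {i | v ∈ bag i}).Connected) ∧
    (∀ i, (bag i).ncard ≤ k + 1)

/-- `G` is a `k`-tree: its vertices admit a construction order in which the first
`k+1` vertices form a complete graph and every later vertex is joined to exactly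
`k` earlier, pairwise adjacent, vertices. -/
def IsKTree (k : ℕ) {V : Type} (G : SimpleGraph V) : Prop :=
  ∃ (n : ℕ) (e : Fin n ≃ V), k + 1 ≤ n ∧
    (∀ i j : Fin n, (i : ℕ) < k + 1 → (j : ℕ) < k + 1 → i ≠ j → G.Adj (e i) (e j)) ∧
    (∀ j : Fin n, k + 1 ≤ (j : ℕ) →
      {i : Fin n | i < j ∧ G.Adj (e i) (e j)}.ncard = k ∧
      (∀ i i' : Fin n, i < j → i' < j → G.Adj (e i) (e j) → G.Adj (e i') (e j) →
        i ≠ i' → G.Adj (e i) (e i')))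

/-- `S` is a dominating set of `G`. -/
def IsDomSet {V : Type} (G : SimpleGraph V) (S : Set V) : Prop :=
  ∀ v : V, v ∈ S ∨ ∃ u ∈ S, G.Adj u v

/-- `S` is a connected dominating set of `G`. -/
def IsConnDomSet {V : Type} (G : SimpleGraph V) (S : Set V) : Prop :=
  IsDomSet G S ∧ (G.induce S).Connected

/-- The domination number `γ(G)`. -/
noncomputable def domNum {V : Type} [Fintype V] (G : SimpleGraph V) : ℕ :=
  sInf {n | ∃ S : Finset V, IsDomSet G ↑S ∧ S.card = n}

/-- The connected domination number `γ_c(G)`. -/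
noncomputable def connDomNum {V : Type} [Fintype V] (G : SimpleGraph V) : ℕ :=
  sInf {n | ∃ S : Finset V, IsConnDomSet G ↑S ∧ S.card = n}

/-- A graph is Eulerian if every vertex has even degree. -/
def IsEulerian {V : Type} (G : SimpleGraph V) : Prop :=
  ∀ v : V, Even (G.neighborSet v).ncard

/-- `G` contains a subgraph isomorphic to `H`. -/
def ContainsCopy {W V : Type} (H : SimpleGraph W) (G : SimpleGraph V) : Prop :=
  ∃ f : H →g G, Function.Injective ⇑f

/-- The complete tripartite graph `K_{1,1,3}`. -/
def K113 : SimpleGraph (Fin 5) :=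
  SimpleGraph.fromEdgeSet {s(0, 1), s(0, 2), s(0, 3), s(0, 4), s(1, 2), s(1, 3), s(1, 4)}

/-- `G` is a maximal outerplanar graph. -/
def IsMaximalOuterplanar {V : Type} (G : SimpleGraph V) : Prop :=
  IsOuterplanar G ∧ ∀ u v : V, u ≠ v → ¬ G.Adj u v →
    ¬ IsOuterplanar (G ⊔ SimpleGraph.fromEdgeSet {s(u, v)})

section TopologicalKFive

open Complex

/-- `δ` is the total change of a continuous logarithm of `g` along `[0, 1]`. -/
def IsLogChange (g : ℝ → ℂ) (δ : ℂ) : Prop :=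
  ∃ L : ℝ → ℂ, Continuous L ∧ (∀ t, exp (L t) = g t) ∧ L 1 - L 0 = δ

theorem IsLogChange.unique {g : ℝ → ℂ} {δ δ' : ℂ} (h : IsLogChange g δ)
    (h' : IsLogChange g δ') : δ = δ' := by
  obtain ⟨L, hL, hLg, rfl⟩ := h
  obtain ⟨M, hM, hMg, rfl⟩ := h'
  have key : ∀ t, ∃ n : ℤ, L t = M t + n * (2 * Real.pi * I) := fun t =>
    exp_eq_exp_iff_exists_int.1 ((hLg t).trans (hMg t).symm)
  choose n hn using key
  have hcont : Continuous fun t => (n t : ℝ) := by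
    have : (fun t => (n t : ℝ)) = fun t => ((L t - M t) / (2 * Real.pi * I)).re := by
      funext t
      rw [hn t, add_sub_cancel_left, mul_div_cancel_right₀ _ two_pi_I_ne_zero]
      simp
    rw [this]
    fun_prop
  have hn' : Continuous n := Int.isClosedEmbedding_coe_real.isEmbedding.continuous_iff.2 hcont
  have h01 : n 1 = n 0 := PreconnectedSpace.constant inferInstance hn'
  rw [hn 1, hn 0, h01]
  ring

theorem IsLogChange.neg {g : ℝ → ℂ} {δ : ℂ} (h : IsLogChange g δ) :
    IsLogChange (fun t => -g t) δ := by
  obtain ⟨L, hL, hLg, rfl⟩ := h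
  exact ⟨fun t => L t + Real.pi * I, by fun_prop, fun t => by simp [exp_add, hLg], by ring⟩

theorem IsLogChange.exp_mul {g : ℝ → ℂ} {δ : ℂ} (h : IsLogChange g δ) :
    exp δ * g 0 = g 1 := by
  obtain ⟨L, hL, hLg, rfl⟩ := h
  rw [← hLg, ← hLg, ← exp_add, sub_add_cancel]

/-- Additivity of the change of the logarithm of `f t - e s` around the unit square. -/
theorem exists_isLogChange_of_disjoint {e f : ℝ → ℂ} (he : Continuous e) (hf : Continuous f)
    (hef : ∀ s t, e s ≠ f t) :
    ∃ α β γ δ, IsLogChange (fun t => f t - e 0) α ∧ IsLogChange (fun s => e s - f 1) β ∧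
      IsLogChange (fun s => e s - f 0) γ ∧ IsLogChange (fun t => f t - e 1) δ ∧
      α + β = γ + δ := by
  obtain ⟨L, hL, hLe⟩ := exists_continuousOn_eqOn_exp_comp (X := ℝ × ℝ) (U := Set.univ)
    (g := fun x => f x.2 - e x.1)
    (by
      have := (convex_univ (𝕜 := ℝ) (E := ℝ × ℝ)).contractibleSpace Set.univ_nonempty
      exact SimplyConnectedSpace.ofContractible _) isOpen_univ
    (Continuous.continuousOn (by fun_prop)) (by
      rintro ⟨x, -, hx⟩
      exact hef _ _ (sub_eq_zero.1 hx).symm)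
  rw [continuousOn_univ] at hL
  have hLe' : ∀ s t, exp (L (s, t)) = f t - e s := fun s t => hLe (Set.mem_univ (s, t))
  refine ⟨L (0, 1) - L (0, 0), L (1, 1) - L (0, 1), L (1, 0) - L (0, 0), L (1, 1) - L (1, 0),
    ⟨fun t => L (0, t), by fun_prop, fun t => hLe' 0 t, rfl⟩, ?_, ?_,
    ⟨fun t => L (1, t), by fun_prop, fun t => hLe' 1 t, rfl⟩, by ring⟩
  · have : IsLogChange (fun s => f 1 - e s) (L (1, 1) - L (0, 1)) :=
      ⟨fun s => L (s, 1), by fun_prop, fun s => hLe' s 1, rfl⟩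
    simpa using this.neg
  · have : IsLogChange (fun s => f 0 - e s) (L (1, 0) - L (0, 0)) :=
      ⟨fun s => L (s, 0), by fun_prop, fun s => hLe' s 0, rfl⟩
    simpa using this.neg

/-- A topological `K₅` cannot be drawn in the plane, even when edges sharing an endpoint are
allowed to meet. -/
theorem not_planar_complete_five (P : Fin 5 → ℂ) (γ : Fin 5 → Fin 5 → ℝ → ℂ)
    (hγ : ∀ i j, i < j → Continuous (γ i j) ∧ γ i j 0 = P i ∧ γ i j 1 = P j)
    (hdisj : ∀ i j k l, i < j → k < l → i ≠ k → i ≠ l → j ≠ k → j ≠ l →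
      ∀ s t, γ i j s ≠ γ k l t) : False := by
  have hP : ∀ i j, i ≠ j → P j - P i ≠ 0 := by
    intro i j hij h
    obtain ⟨k, l, h1, h2, h3, h4⟩ : ∃ k l : Fin 5, i ≠ k ∧ j ≠ l ∧ k ≠ l ∧ (i ≠ l ∧ j ≠ k) := by
      clear h; revert i j; decide
    have hk : ∀ a b : Fin 5, a ≠ b → ∃ c d s, c < d ∧ γ c d s = P a ∧
        ((c = a ∧ d = b) ∨ (c = b ∧ d = a)) := by
      intro a b hab
      rcases lt_or_gt_of_ne hab with h | h
      · exact ⟨a, b, 0, h, (hγ a b h).2.1, .inl ⟨rfl, rfl⟩⟩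
      · exact ⟨b, a, 1, h, (hγ b a h).2.2, .inr ⟨rfl, rfl⟩⟩
    obtain ⟨c, d, s, hcd, hs, hc⟩ := hk i k h1
    obtain ⟨c', d', s', hcd', hs', hc'⟩ := hk j l h2
    refine hdisj c d c' d' hcd hcd' ?_ ?_ ?_ ?_ s s' (by rw [hs, hs', sub_eq_zero.1 h]) <;>
      rcases hc with ⟨rfl, rfl⟩ | ⟨rfl, rfl⟩ <;> rcases hc' with ⟨rfl, rfl⟩ | ⟨rfl, rfl⟩ <;>
      tauto
  let b : Fin 5 → Fin 5 → ℂ := fun x y => log (P (max x y) - P (min x y))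
  let σ : Fin 5 → Fin 5 → ℤ := fun x y => if x < y then 0 else 1
  have hb : ∀ x y, x ≠ y → exp (b x y + σ x y * (Real.pi * I)) = P y - P x := by
    intro x y hxy
    rcases lt_or_gt_of_ne hxy with h | h
    · simp [b, σ, h, max_eq_right h.le, min_eq_left h.le, exp_log (hP x y hxy)]
    · simp [b, σ, not_lt.2 h.le, max_eq_left h.le, min_eq_right h.le, exp_add,
        exp_log (hP y x hxy.symm)]
  have hm : ∀ w c d, ∃ m : ℤ, ∀ δ, c < d → w ≠ c → w ≠ d → IsLogChange (fun t => γ c d t - P w) δ →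
      δ = b w d - b w c + (σ w d - σ w c + 2 * m) * (Real.pi * I) := by
    intro w c d
    by_cases H : ∃ δ, c < d ∧ w ≠ c ∧ w ≠ d ∧ IsLogChange (fun t => γ c d t - P w) δ
    · obtain ⟨δ, hcd, hwc, hwd, hδ⟩ := H
      have h1 := hδ.exp_mul
      simp only [(hγ c d hcd).2.1, (hγ c d hcd).2.2, ← hb w c hwc, ← hb w d hwd, ← exp_add] at h1
      obtain ⟨m, hm⟩ := exp_eq_exp_iff_exists_int.1 h1
      refine ⟨m, fun δ' _ _ _ hδ' => ?_⟩
      rw [hδ'.unique hδ]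
      linear_combination hm
    · exact ⟨0, fun δ h1 h2 h3 h4 => (H ⟨δ, h1, h2, h3, h4⟩).elim⟩
  choose m hm using hm
  have main : ∀ a b c d, a < b → c < d → a ≠ c → a ≠ d → b ≠ c → b ≠ d →
      σ a d - σ a c + 2 * m a c d + (σ d b - σ d a + 2 * m d a b) =
      σ c b - σ c a + 2 * m c a b + (σ b d - σ b c + 2 * m b c d) := by
    intro x y c d hab hcd hac had hbc hbd
    obtain ⟨α, β, δ, ε, h1, h2, h3, h4, h5⟩ :=
      exists_isLogChange_of_disjoint (hγ x y hab).1 (hγ c d hcd).1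
        (hdisj x y c d hab hcd hac had hbc hbd)
    rw [(hγ x y hab).2.1] at h1
    rw [(hγ c d hcd).2.2] at h2
    rw [(hγ c d hcd).2.1] at h3
    rw [(hγ x y hab).2.2] at h4
    rw [hm _ _ _ _ hcd hac had h1, hm _ _ _ _ hab had.symm hbd.symm h2,
      hm _ _ _ _ hab hac.symm hbc.symm h3, hm _ _ _ _ hcd hbc hbd h4] at h5
    have hbs : ∀ x y, b x y = b y x := fun x y => by simp [b, max_comm, min_comm]
    rw [hbs d y, hbs d x, hbs c y, hbs c x] at h5
    have hpi : (Real.pi * I : ℂ) ≠ 0 := by simp [Real.pi_ne_zero]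
    have : ((σ x d - σ x c + 2 * m x c d + (σ d y - σ d x + 2 * m d x y) : ℤ) : ℂ) =
        ((σ c y - σ c x + 2 * m c x y + (σ y d - σ y c + 2 * m y c d) : ℤ) : ℂ) := by
      refine mul_right_cancel₀ hpi ?_
      push_cast
      linear_combination h5
    exact_mod_cast this
  have e1 := main 0 1 2 3 (by decide) (by decide) (by decide) (by decide) (by decide) (by decide)
  have e2 := main 0 1 2 4 (by decide) (by decide) (by decide) (by decide) (by decide) (by decide)
  have e3 := main 0 1 3 4 (by decide) (by decide) (by decide) (by decide) (by decide) (by decide)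
  have e4 := main 0 2 1 3 (by decide) (by decide) (by decide) (by decide) (by decide) (by decide)
  have e5 := main 0 2 1 4 (by decide) (by decide) (by decide) (by decide) (by decide) (by decide)
  have e6 := main 0 2 3 4 (by decide) (by decide) (by decide) (by decide) (by decide) (by decide)
  have e7 := main 0 3 1 2 (by decide) (by decide) (by decide) (by decide) (by decide) (by decide)
  have e8 := main 0 3 1 4 (by decide) (by decide) (by decide) (by decide) (by decide) (by decide)
  have e9 := main 0 3 2 4 (by decide) (by decide) (by decide) (by decide) (by decide) (by decide)
  have e10 := main 0 4 1 2 (by decide) (by decide) (by decide) (by decide) (by decide) (by decide)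
  have e11 := main 0 4 1 3 (by decide) (by decide) (by decide) (by decide) (by decide) (by decide)
  have e12 := main 0 4 2 3 (by decide) (by decide) (by decide) (by decide) (by decide) (by decide)
  have e13 := main 1 2 3 4 (by decide) (by decide) (by decide) (by decide) (by decide) (by decide)
  have e14 := main 1 3 2 4 (by decide) (by decide) (by decide) (by decide) (by decide) (by decide)
  have e15 := main 1 4 2 3 (by decide) (by decide) (by decide) (by decide) (by decide) (by decide)
  simp [σ] at e1 e2 e3 e4 e5 e6 e7 e8 e9 e10 e11 e12 e13 e14 e15
  omega

end TopologicalKFive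

section BranchSets

variable {V : Type}

/-- Vertex sets that can be assembled from single vertices by repeatedly uniting two sets
joined by an edge. -/
inductive EdgeConnected (G : SimpleGraph V) : Set V → Prop
  | single (v : V) : EdgeConnected G {v}
  | union {A B : Set V} {a b : V} (hA : EdgeConnected G A) (hB : EdgeConnected G B)
      (ha : a ∈ A) (hb : b ∈ B) (hab : G.Adj a b) : EdgeConnected G (A ∪ B)

theorem EdgeConnected.nonempty {G : SimpleGraph V} {B : Set V} (h : EdgeConnected G B) :
    B.Nonempty := by
  induction h with
  | single v => exact ⟨v, rfl⟩
  | union _ _ ha _ _ => exact ⟨_, Or.inl ha⟩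

namespace PlaneEmbedding

variable {G : SimpleGraph V} (E : PlaneEmbedding G)

theorem subSupport_mono {A B : Set V} (h : A ⊆ B) : E.subSupport A ⊆ E.subSupport B := by
  rintro p (⟨v, hv, rfl⟩ | hp)
  · exact Or.inl ⟨v, h hv, rfl⟩
  · simp only [Set.mem_iUnion] at hp
    obtain ⟨u, hu, v, hv, huv, hp⟩ := hp
    refine Or.inr ?_
    simp only [Set.mem_iUnion]
    exact ⟨u, h hu, v, h hv, huv, hp⟩

theorem arc_subset_subSupport {S : Set V} {u v : V} (hu : u ∈ S) (hv : v ∈ S) (h : G.Adj u v) :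
    E.arc h ⊆ E.subSupport S := by
  intro p hp
  refine Or.inr ?_
  simp only [Set.mem_iUnion]
  exact ⟨u, hu, v, hv, h, hp⟩

theorem disjoint_subSupport {A B : Set V} (h : Disjoint A B) :
    Disjoint (E.subSupport A) (E.subSupport B) := by
  rw [Set.disjoint_left] at h ⊢
  rintro p (⟨v, hv, rfl⟩ | hp) (⟨w, hw, hwv⟩ | hq)
  · exact h hv (E.vtx_inj hwv ▸ hw)
  · simp only [Set.mem_iUnion] at hq
    obtain ⟨a, ha, b, hb, hab, hq⟩ := hq
    rcases E.arc_vtx hab v hq with rfl | rfl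
    exacts [h hv ha, h hv hb]
  · simp only [Set.mem_iUnion] at hp
    obtain ⟨a, ha, b, hb, hab, hp⟩ := hp
    rcases E.arc_vtx hab w (hwv ▸ hp) with rfl | rfl
    exacts [h ha hw, h hb hw]
  · simp only [Set.mem_iUnion] at hp hq
    obtain ⟨a, ha, b, hb, hab, hp⟩ := hp
    obtain ⟨c, hc, d, hd, hcd, hq⟩ := hq
    have hne : s(a, b) ≠ s(c, d) := by
      rw [Ne, Sym2.eq_iff]
      rintro (⟨rfl, -⟩ | ⟨rfl, -⟩)
      exacts [h ha hc, h ha hd]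
    obtain ⟨h1, h2⟩ := E.arc_inter hab hcd hne ⟨hp, hq⟩
    simp only [Set.mem_insert_iff, Set.mem_singleton_iff] at h1 h2
    rcases h1 with rfl | rfl <;> rcases h2 with h2 | h2 <;> have := E.vtx_inj h2 <;> subst this
    exacts [h ha hc, h ha hd, h hb hc, h hb hd]

theorem joinedIn_arc {u v : V} (h : G.Adj u v) : JoinedIn (E.arc h) (E.vtx u) (E.vtx v) := by
  obtain ⟨γ, -, hγ⟩ := E.arc_path h
  exact ⟨γ, fun t => hγ ▸ Set.mem_range_self t⟩

theorem joinedIn_subSupport {B : Set V} (hB : EdgeConnected G B) {a b : V} (ha : a ∈ B)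
    (hb : b ∈ B) : JoinedIn (E.subSupport B) (E.vtx a) (E.vtx b) := by
  induction hB generalizing a b with
  | single v =>
    rw [Set.mem_singleton_iff] at ha hb
    subst ha hb
    exact JoinedIn.refl (Or.inl ⟨_, rfl, rfl⟩)
  | @union A B x y hA hB hx hy hxy ihA ihB =>
    have hxy' : JoinedIn (E.subSupport (A ∪ B)) (E.vtx x) (E.vtx y) :=
      (E.joinedIn_arc hxy).mono (E.arc_subset_subSupport (Or.inl hx) (Or.inr hy) hxy)
    have key : ∀ a ∈ A ∪ B, JoinedIn (E.subSupport (A ∪ B)) (E.vtx a) (E.vtx x) := by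
      rintro a (ha | ha)
      · exact (ihA ha hx).mono (E.subSupport_mono Set.subset_union_left)
      · exact ((ihB ha hy).mono (E.subSupport_mono Set.subset_union_right)).trans hxy'.symm
    exact (key a ha).trans (key b hb).symm

/-- A plane graph has no `K₅` minor. -/
theorem not_complete_five_minor (E : PlaneEmbedding G) (B : Fin 5 → Set V)
    (hB : ∀ i, EdgeConnected G (B i))
    (hdisj : ∀ i j, i < j → Disjoint (B i) (B j))
    (hadj : ∀ i j, i < j → ∃ u ∈ B i, ∃ v ∈ B j, G.Adj u v) : False := by
  choose r hr using fun i => (hB i).nonempty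
  have hjoin : ∀ i j, i < j →
      JoinedIn (E.subSupport (B i ∪ B j)) (E.vtx (r i)) (E.vtx (r j)) := by
    intro i j hij
    obtain ⟨u, hu, v, hv, huv⟩ := hadj i j hij
    exact E.joinedIn_subSupport ((hB i).union (hB j) hu hv huv) (Or.inl (hr i)) (Or.inr (hr j))
  have hdisj' : ∀ i j, i ≠ j → Disjoint (B i) (B j) := fun i j hij =>
    hij.lt_or_gt.elim (hdisj i j) fun h => (hdisj j i h).symm
  let f := Complex.equivRealProdCLM.symm
  let γ : Fin 5 → Fin 5 → ℝ → ℂ := fun i j t =>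
    if h : i < j then f ((hjoin i j h).somePath.extend t) else 0
  refine not_planar_complete_five (fun i => f (E.vtx (r i))) γ ?_ ?_
  · intro i j hij
    refine ⟨?_, ?_, ?_⟩
    · simp only [γ, dif_pos hij]
      exact f.continuous.comp (Path.continuous_extend _)
    · simp only [γ, dif_pos hij, Path.extend_zero]
    · simp only [γ, dif_pos hij, Path.extend_one]
  · intro i j k l hij hkl hik hil hjk hjl s t
    simp only [γ, dif_pos hij, dif_pos hkl]
    intro h
    have hD : Disjoint (B i ∪ B j) (B k ∪ B l) := by
      simp only [Set.disjoint_union_left, Set.disjoint_union_right]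
      exact ⟨⟨hdisj' _ _ hik, hdisj' _ _ hjk⟩, hdisj' _ _ hil, hdisj' _ _ hjl⟩
    have h1 := (hjoin i j hij).somePath_mem (Set.projIcc 0 1 zero_le_one s)
    have h2 := (hjoin k l hkl).somePath_mem (Set.projIcc 0 1 zero_le_one t)
    have h3 : (hjoin i j hij).somePath (Set.projIcc 0 1 zero_le_one s) =
        (hjoin k l hkl).somePath (Set.projIcc 0 1 zero_le_one t) := f.injective h
    exact Set.disjoint_left.1 (E.disjoint_subSupport hD) h1 (h3 ▸ h2)

end PlaneEmbedding

end BranchSets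

section NestedOctahedra

/-- Addresses of the triangles obtained by repeatedly inserting an octahedron into a triangle and
passing to the central triangle (`none`) or to the triangle resting on the `j`-th side
(`some j`).  The head of the list is the last step. -/
abbrev Word := List (Option (Fin 3))

/-- The three corners of the initial triangle, together with the three inner vertices of the
octahedron inserted into each triangle. -/
abbrev Vert := Fin 3 ⊕ (Word × Fin 3)

/-- The corners of the triangle `τ` of an octahedron; `Sum.inl` are the outer, `Sum.inr` the
inner vertices of the octahedron. -/
def childFace : Option (Fin 3) → Fin 3 → Fin 3 ⊕ Fin 3
  | none => Sum.inr
  | some j => ![Sum.inl j, Sum.inl (j + 1), Sum.inr j]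

/-- The corners of the triangle with address `w`. -/
def face : Word → Fin 3 → Vert
  | [] => Sum.inl
  | τ :: w => fun c => Sum.elim (face w) (fun d => Sum.inr (w, d)) (childFace τ c)

/-- The vertices of the octahedron inserted into the triangle `w`. -/
def oct (w : Word) : Fin 3 ⊕ Fin 3 → Vert := Sum.elim (face w) (fun d => Sum.inr (w, d))

theorem face_cons (τ : Option (Fin 3)) (w : Word) (c : Fin 3) :
    face (τ :: w) c = oct w (childFace τ c) := rfl

@[simp] theorem oct_inl (w : Word) (c : Fin 3) : oct w (Sum.inl c) = face w c := rfl

@[simp] theorem oct_inr (w : Word) (c : Fin 3) : oct w (Sum.inr c) = Sum.inr (w, c) := rfl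

/-- The edges of the nested octahedra, listed once each. -/
inductive NestedEdge : Vert → Vert → Prop
  | base (c : Fin 3) : NestedEdge (Sum.inl c) (Sum.inl (c + 1))
  | inner (w : Word) (c : Fin 3) : NestedEdge (Sum.inr (w, c)) (Sum.inr (w, c + 1))
  | spoke (w : Word) (c : Fin 3) : NestedEdge (Sum.inr (w, c)) (face w c)
  | spokeSucc (w : Word) (c : Fin 3) : NestedEdge (Sum.inr (w, c)) (face w (c + 1))

/-- The vertices lying strictly inside the triangle `w`. -/
def inside (w : Word) : Set Vert := {x | Sum.elim (fun _ => False) (fun p => w <:+ p.1) x}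

@[simp] theorem inl_mem_inside (w : Word) (c : Fin 3) : Sum.inl c ∉ inside w := id

@[simp] theorem inr_mem_inside (w p : Word) (c : Fin 3) :
    (Sum.inr (p, c) : Vert) ∈ inside w ↔ w <:+ p := Iff.rfl

theorem cons_not_suffix (τ : Option (Fin 3)) (w : Word) : ¬ τ :: w <:+ w := fun h => by
  have := h.length_le
  simp at this

theorem inside_cons_subset (τ : Option (Fin 3)) (w : Word) : inside (τ :: w) ⊆ inside w := by
  rintro (c | ⟨p, c⟩) h
  · exact h
  · exact (List.suffix_cons τ w).trans h

theorem face_notMem_inside (w : Word) (c : Fin 3) : face w c ∉ inside w := by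
  induction w generalizing c with
  | nil => exact id
  | cons τ w ih =>
    rw [face_cons]
    rcases childFace τ c with d | d
    · exact fun h => ih d (inside_cons_subset τ w h)
    · exact cons_not_suffix τ w

theorem inr_ne_face (w : Word) (c d : Fin 3) : (Sum.inr (w, c) : Vert) ≠ face w d := fun h =>
  face_notMem_inside w d (h ▸ List.suffix_rfl)

theorem childFace_injective (τ : Option (Fin 3)) : Function.Injective (childFace τ) := by
  intro a b
  revert τ a b
  decide

theorem face_injective (w : Word) : Function.Injective (face w) := by
  induction w with
  | nil => exact Sum.inl_injective
  | cons τ w ih =>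
    intro a b h
    apply childFace_injective τ
    rw [face_cons, face_cons] at h
    rcases ha : childFace τ a with c | c <;> rcases hb : childFace τ b with d | d <;>
      rw [ha, hb] at h
    · rw [ih h]
    · exact (inr_ne_face w d c h.symm).elim
    · exact (inr_ne_face w c d h).elim
    · simpa using h

theorem oct_injective (w : Word) : Function.Injective (oct w) := by
  rintro (a | a) (b | b) h
  · rw [face_injective w h]
  · exact (inr_ne_face w b a h.symm).elim
  · exact (inr_ne_face w a b h).elim
  · simpa using h

/-- The infinite graph of all nested octahedra. -/
def nested : SimpleGraph Vert where
  Adj a b := NestedEdge a b ∨ NestedEdge b a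
  symm := ⟨fun _ _ => Or.symm⟩
  loopless := ⟨by
    have h : ∀ a b, NestedEdge a b → a ≠ b := by
      rintro _ _ (c | ⟨w, c⟩ | ⟨w, c⟩ | ⟨w, c⟩)
      · simp
      · simp
      · exact inr_ne_face _ _ _
      · exact inr_ne_face _ _ _
    exact fun a ha => ha.elim (fun ha => h a a ha rfl) fun ha => h a a ha rfl⟩

/-- Adjacency in the octahedron, in which `Sum.inr c` is antipodal to `Sum.inl (c + 2)`. -/
def octAdj : Fin 3 ⊕ Fin 3 → Fin 3 ⊕ Fin 3 → Bool
  | Sum.inl a, Sum.inl b => a ≠ b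
  | Sum.inr a, Sum.inr b => a ≠ b
  | Sum.inl a, Sum.inr b => a ≠ b + 2
  | Sum.inr a, Sum.inl b => b ≠ a + 2

theorem ne_cases_fin_three : ∀ a b : Fin 3, a ≠ b → b = a + 1 ∨ a = b + 1 := by decide

theorem ne_add_two_cases : ∀ a b : Fin 3, b ≠ a + 2 → b = a ∨ b = a + 1 := by decide

theorem octAdj_childFace : ∀ (τ : Option (Fin 3)) (a b : Fin 3), a ≠ b →
    octAdj (childFace τ a) (childFace τ b) = true := by decide

theorem nested_adj_inr {w : Word} {a b : Fin 3} (h : a ≠ b) :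
    nested.Adj (Sum.inr (w, a)) (Sum.inr (w, b)) := by
  rcases ne_cases_fin_three a b h with rfl | rfl
  · exact Or.inl (.inner w a)
  · exact Or.inr (.inner w b)

theorem nested_adj_spoke {w : Word} {a b : Fin 3} (h : b ≠ a + 2) :
    nested.Adj (Sum.inr (w, a)) (face w b) := by
  rcases ne_add_two_cases a b h with rfl | rfl
  · exact Or.inl (.spoke w b)
  · exact Or.inl (.spokeSucc w a)

theorem nested_adj_face {w : Word} {a b : Fin 3} (h : a ≠ b) :
    nested.Adj (face w a) (face w b) := by
  induction w generalizing a b with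
  | nil =>
    rcases ne_cases_fin_three a b h with rfl | rfl
    · exact Or.inl (.base a)
    · exact Or.inr (.base b)
  | cons τ w ih =>
    have hab := octAdj_childFace τ a b h
    rw [face_cons, face_cons]
    generalize childFace τ a = x, childFace τ b = y at hab
    rcases x with c | c <;> rcases y with d | d <;> simp only [octAdj, decide_eq_true_eq] at hab
    · exact ih hab
    · exact (nested_adj_spoke hab).symm
    · exact nested_adj_spoke hab
    · exact nested_adj_inr hab

theorem nested_adj_oct {w : Word} {x y : Fin 3 ⊕ Fin 3} (h : octAdj x y = true) :
    nested.Adj (oct w x) (oct w y) := by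
  rcases x with c | c <;> rcases y with d | d <;> simp only [octAdj, decide_eq_true_eq] at h
  · exact nested_adj_face h
  · exact (nested_adj_spoke h).symm
  · exact nested_adj_spoke h
  · exact nested_adj_inr h

end NestedOctahedra

section Fans

/-- There are three disjoint connected sets inside `Z`, the `c`-th one containing `t c`, each
adjacent to but not containing `u`. -/
def Fan (u : Vert) (t : Fin 3 → Vert) (Z : Set Vert) : Prop :=
  ∃ X : Fin 3 → Set Vert,
    (∀ c, EdgeConnected nested (X c) ∧ t c ∈ X c ∧ X c ⊆ Z ∧ u ∉ X c ∧ ∃ x ∈ X c, nested.Adj u x) ∧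
    ∀ c d, c ≠ d → Disjoint (X c) (X d)

theorem Fan.reindex {u : Vert} {t : Fin 3 → Vert} {Z : Set Vert} (h : Fan u t Z)
    {π : Fin 3 → Fin 3} (hπ : Function.Injective π) {s : Fin 3 → Vert} (hs : ∀ c, s c = t (π c)) :
    Fan u s Z := by
  obtain ⟨X, hX, hd⟩ := h
  refine ⟨fun c => X (π c), fun c => ?_, fun c d hcd => hd _ _ (hπ.ne hcd)⟩
  rw [hs]
  exact hX _

/-- In the octahedron, `t` is linked to `t'` by three disjoint paths with middle vertices `m`
whose new vertices avoid `t`. -/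
def Link (t m t' : Fin 3 → Fin 3 ⊕ Fin 3) : Prop :=
  (∀ c, m c = t c ∨ octAdj (t c) (m c) = true ∧ ∀ d, m c ≠ t d) ∧
  (∀ c, t' c = m c ∨ octAdj (m c) (t' c) = true ∧ ∀ d, t' c ≠ t d) ∧
  ∀ c d, c ≠ d → m c ≠ m d ∧ m c ≠ t' d ∧ t' c ≠ t' d

instance (t m t' : Fin 3 → Fin 3 ⊕ Fin 3) : Decidable (Link t m t') := by
  unfold Link
  infer_instance

theorem edgeConnected_union_singleton {V : Type} {G : SimpleGraph V} {A : Set V} {a b : V}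
    (hA : EdgeConnected G A) (ha : a ∈ A) (h : b = a ∨ G.Adj a b) : EdgeConnected G (A ∪ {b}) := by
  rcases h with rfl | h
  · rwa [Set.union_eq_self_of_subset_right (Set.singleton_subset_iff.2 ha)]
  · exact hA.union (.single b) ha rfl h

theorem Fan.extend {u : Vert} {w : Word} {t m t' : Fin 3 → Fin 3 ⊕ Fin 3} {Z Z' : Set Vert}
    (h : Fan u (fun c => oct w (t c)) Z) (hl : Link t m t')
    (hZ : ∀ x, oct w x ∈ Z → ∃ c, x = t c) (hu : ∀ x, oct w x = u → ∃ c, x = t c)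
    (hZZ' : Z ⊆ Z') (hm : ∀ c, oct w (m c) ∈ Z') (ht' : ∀ c, oct w (t' c) ∈ Z') :
    Fan u (fun c => oct w (t' c)) Z' := by
  obtain ⟨X, hX, hd⟩ := h
  obtain ⟨l1, l2, l3⟩ := hl
  have hmX : ∀ c, oct w (m c) ∈ X c ∨ oct w (m c) ∉ Z ∧ oct w (m c) ≠ u := by
    intro c
    rcases l1 c with h | ⟨-, h⟩
    · exact Or.inl (h ▸ (hX c).2.1)
    · exact Or.inr ⟨fun hz => (hZ _ hz).elim h, fun hz => (hu _ hz).elim h⟩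
  have htX : ∀ c, oct w (t' c) ∈ X c ∨ oct w (t' c) ∉ Z ∧ oct w (t' c) ≠ u := by
    intro c
    rcases l2 c with h | ⟨-, h⟩
    · exact h ▸ hmX c
    · exact Or.inr ⟨fun hz => (hZ _ hz).elim h, fun hz => (hu _ hz).elim h⟩
  have hcross : ∀ c d, c ≠ d → ∀ y ∈ X c, ∀ z, z ∈ X d ∨ z ∉ Z ∧ z ≠ u → y ≠ z := by
    rintro c d hcd y hy _ hz rfl
    rcases hz with hz | hz
    · exact Set.disjoint_left.1 (hd c d hcd) hy hz
    · exact hz.1 ((hX c).2.2.1 hy)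
  refine ⟨fun c => X c ∪ {oct w (m c)} ∪ {oct w (t' c)}, fun c => ⟨?_, ?_, ?_, ?_, ?_⟩, ?_⟩
  · refine edgeConnected_union_singleton (edgeConnected_union_singleton (hX c).1 (hX c).2.1 ?_)
      (Or.inr rfl) ?_
    · exact (l1 c).imp (congrArg (oct w)) fun h => nested_adj_oct h.1
    · exact (l2 c).imp (congrArg (oct w)) fun h => nested_adj_oct h.1
  · exact Or.inr rfl
  · rintro y ((hy | rfl) | rfl)
    exacts [hZZ' ((hX c).2.2.1 hy), hm c, ht' c]
  · rintro ((hy | hy) | hy)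
    · exact (hX c).2.2.2.1 hy
    · rcases hmX c with h | h
      exacts [(hX c).2.2.2.1 (hy ▸ h), h.2 hy.symm]
    · rcases htX c with h | h
      exacts [(hX c).2.2.2.1 (hy ▸ h), h.2 hy.symm]
  · obtain ⟨x, hx, hux⟩ := (hX c).2.2.2.2
    exact ⟨x, Or.inl (Or.inl hx), hux⟩
  · intro c d hcd
    have hinj := fun x y => (oct_injective w).ne (a₁ := x) (a₂ := y)
    have h3 := l3 c d hcd
    have h3' := l3 d c hcd.symm
    rw [Set.disjoint_left]
    rintro y ((hy | rfl) | rfl) ((hz | hz) | hz)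
    · exact Set.disjoint_left.1 (hd c d hcd) hy hz
    · exact hcross c d hcd y hy _ (hmX d) hz
    · exact hcross c d hcd y hy _ (htX d) hz
    · exact hcross d c hcd.symm _ hz _ (hmX c) rfl
    · exact hinj _ _ h3.1 hz
    · exact hinj _ _ h3.2.1 hz
    · exact hcross d c hcd.symm _ hz _ (htX c) rfl
    · exact hinj _ _ h3'.2.1 hz.symm
    · exact hinj _ _ h3.2.2 hz

/-- Three disjoint paths in the octahedron from `v` to `t`, with middle vertices `m`. -/
def DirectFan (v : Fin 3 ⊕ Fin 3) (t m : Fin 3 → Fin 3 ⊕ Fin 3) : Prop :=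
  (∀ c, (m c = t c ∨ octAdj (t c) (m c) = true) ∧ octAdj v (m c) = true ∧ v ≠ t c ∧ v ≠ m c) ∧
  ∀ c d, c ≠ d → m c ≠ m d ∧ m c ≠ t d ∧ t c ≠ t d

instance (v : Fin 3 ⊕ Fin 3) (t m : Fin 3 → Fin 3 ⊕ Fin 3) : Decidable (DirectFan v t m) := by
  unfold DirectFan
  infer_instance

theorem DirectFan.fan {v : Fin 3 ⊕ Fin 3} {t m : Fin 3 → Fin 3 ⊕ Fin 3} (h : DirectFan v t m)
    (w : Word) {Z : Set Vert} (ht : ∀ c, oct w (t c) ∈ Z) (hm : ∀ c, oct w (m c) ∈ Z) :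
    Fan (oct w v) (fun c => oct w (t c)) Z := by
  have hinj := fun x y => (oct_injective w).ne (a₁ := x) (a₂ := y)
  refine ⟨fun c => {oct w (t c)} ∪ {oct w (m c)}, fun c => ⟨?_, Or.inl rfl, ?_, ?_, ?_⟩, ?_⟩
  · exact edgeConnected_union_singleton (.single _) rfl
      ((h.1 c).1.imp (congrArg (oct w)) fun h => nested_adj_oct h)
  · rintro _ (rfl | rfl)
    exacts [ht c, hm c]
  · rintro (h' | h')
    exacts [hinj _ _ (h.1 c).2.2.1 h', hinj _ _ (h.1 c).2.2.2 h']
  · exact ⟨_, Or.inr rfl, nested_adj_oct (h.1 c).2.1⟩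
  · intro c d hcd
    have h3 := h.2 c d hcd
    have h3' := h.2 d c hcd.symm
    rw [Set.disjoint_left]
    rintro _ (rfl | rfl) (hz | hz)
    · exact hinj _ _ h3.2.2 hz
    · exact hinj _ _ h3'.2.1 hz.symm
    · exact hinj _ _ h3.2.1 hz
    · exact hinj _ _ h3.1 hz

/-- The vertices whose address lies in `D`, together with the three base vertices. -/
def vertsOf (D : Set Word) : Set Vert := {x | Sum.elim (fun _ => True) (fun p => p.1 ∈ D) x}

@[simp] theorem inl_mem_vertsOf (D : Set Word) (c : Fin 3) : Sum.inl c ∈ vertsOf D := trivial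

@[simp] theorem inr_mem_vertsOf (D : Set Word) (p : Word) (c : Fin 3) :
    (Sum.inr (p, c) : Vert) ∈ vertsOf D ↔ p ∈ D := Iff.rfl

/-- A set of octWords closed under passing to the enclosing triangle. -/
def IsTailClosed (D : Set Word) : Prop := ∀ τ w, τ :: w ∈ D → w ∈ D

theorem IsTailClosed.of_suffix {D : Set Word} (hD : IsTailClosed D) {p w : Word} (h : w <:+ p)
    (hp : p ∈ D) : w ∈ D := by
  obtain ⟨r, rfl⟩ := h
  induction r with
  | nil => exact hp
  | cons τ r ih => exact ih (hD _ _ hp)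

theorem IsTailClosed.face_mem {D : Set Word} (hD : IsTailClosed D) {w : Word} (hw : w ∈ D)
    (c : Fin 3) : face w c ∈ vertsOf D := by
  induction w generalizing c with
  | nil => trivial
  | cons τ w ih =>
    rw [face_cons]
    rcases childFace τ c with d | d
    · exact ih (hD _ _ hw) d
    · exact hD _ _ hw

theorem IsTailClosed.oct_mem {D : Set Word} (hD : IsTailClosed D) {w : Word} (hw : w ∈ D)
    (x : Fin 3 ⊕ Fin 3) : oct w x ∈ vertsOf D := by
  rcases x with c | c
  · exact hD.face_mem hw c
  · exact hw

/-- The closed triangle `w`, as a vertex set. -/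
def closedInside (w : Word) : Set Vert := inside w ∪ Set.range (face w)

theorem eq_childFace_of_oct_mem {w : Word} {τ : Option (Fin 3)} {x : Fin 3 ⊕ Fin 3}
    (h : oct w x ∈ closedInside (τ :: w)) : ∃ c, x = childFace τ c := by
  rcases h with h | ⟨c, hc⟩
  · rcases x with c | c
    · exact (face_notMem_inside w c (inside_cons_subset τ w h)).elim
    · exact (cons_not_suffix τ w h).elim
  · exact ⟨c, (oct_injective w hc).symm⟩

theorem oct_mem_closedInside (w : Word) (x : Fin 3 ⊕ Fin 3) : oct w x ∈ closedInside w := by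
  rcases x with c | c
  · exact Or.inr ⟨c, rfl⟩
  · exact Or.inl List.suffix_rfl

theorem closedInside_cons_subset (τ : Option (Fin 3)) (w : Word) :
    closedInside (τ :: w) ⊆ closedInside w := by
  rintro x (hx | ⟨c, rfl⟩)
  · exact Or.inl (inside_cons_subset τ w hx)
  · exact oct_mem_closedInside w _

theorem exists_link_inl (τ : Option (Fin 3)) :
    ∃ (m t' : Fin 3 → Fin 3 ⊕ Fin 3) (π : Fin 3 → Fin 3),
      Link (childFace τ) m t' ∧ (∀ a b, π a = π b → a = b) ∧ ∀ c, Sum.inl c = t' (π c) := by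
  rcases τ with _ | j
  · exact ⟨Sum.inl, Sum.inl, id, by decide, by decide, by decide⟩
  · exact ⟨![Sum.inl j, Sum.inl (j + 1), Sum.inr (j + 1)], fun c => Sum.inl (j + c),
      fun c => c - j, by revert j; decide, by revert j; decide, by revert j; decide⟩

theorem exists_link_childFace (τ : Option (Fin 3)) :
    ∃ (m t' : Fin 3 → Fin 3 ⊕ Fin 3) (π : Fin 3 → Fin 3),
      Link Sum.inl m t' ∧ (∀ a b, π a = π b → a = b) ∧ ∀ c, childFace τ c = t' (π c) := by
  rcases τ with _ | j
  · exact ⟨Sum.inr, Sum.inr, id, by decide, by decide, by decide⟩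
  · exact ⟨fun c => if c = j + 2 then Sum.inr (j + 1) else Sum.inl c,
      fun c => if c = j + 2 then Sum.inr j else Sum.inl c,
      fun c => j + c, by revert j; decide, by revert j; decide, by revert j; decide⟩

theorem exists_link_sibling {σ τ : Option (Fin 3)} (h : σ ≠ τ) :
    ∃ (m t' : Fin 3 → Fin 3 ⊕ Fin 3) (π : Fin 3 → Fin 3),
      Link (childFace σ) m t' ∧ (∀ a b, π a = π b → a = b) ∧ ∀ c, childFace τ c = t' (π c) := by
  rcases σ with _ | i <;> rcases τ with _ | j
  · exact (h rfl).elim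
  · refine ⟨fun c => if c = j then Sum.inr j else if c = j + 1 then Sum.inl (j + 1) else Sum.inl j,
      fun c => if c = j then Sum.inr j else if c = j + 1 then Sum.inl (j + 1) else Sum.inl j,
      ![j + 2, j + 1, j], ?_, ?_, ?_⟩ <;> clear h <;> revert j <;> decide
  · refine ⟨![Sum.inr (i + 2), Sum.inr (i + 1), Sum.inr i],
      ![Sum.inr (i + 2), Sum.inr (i + 1), Sum.inr i], fun c => i + 2 - c, ?_, ?_, ?_⟩ <;>
      clear h <;> revert i <;> decide
  · rcases ne_cases_fin_three i j (by simpa using h) with rfl | rfl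
    · refine ⟨![Sum.inl (i + 2), Sum.inl (i + 1), Sum.inr (i + 1)],
        ![Sum.inl (i + 2), Sum.inl (i + 1), Sum.inr (i + 1)], ![1, 0, 2], ?_, ?_, ?_⟩ <;>
        clear h <;> revert i <;> decide
    · refine ⟨![Sum.inl (j + 1), Sum.inl j, Sum.inr j],
        ![Sum.inl (j + 1), Sum.inl j, Sum.inr j], ![1, 0, 2], ?_, ?_, ?_⟩ <;>
        clear h <;> revert j <;> decide

theorem exists_directFan {τ : Option (Fin 3)} {v : Fin 3 ⊕ Fin 3} (h : ∀ c, childFace τ c ≠ v) :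
    ∃ m, DirectFan v (childFace τ) m := by
  rcases τ with _ | j <;> rcases v with c | c
  · refine ⟨fun d => if d = c + 1 then Sum.inl (c + 1) else Sum.inr d, ?_⟩
    clear h; revert c; decide
  · exact (h c rfl).elim
  · refine ⟨![Sum.inl j, Sum.inl (j + 1), Sum.inr (j + 1)], ?_⟩
    revert j c; decide
  · refine ⟨if c = j + 1 then ![Sum.inr (j + 2), Sum.inl (j + 1), Sum.inr j] else
      ![Sum.inl j, Sum.inr (j + 1), Sum.inr j], ?_⟩
    revert j c; decide

theorem fan_inside {D : Set Word} (hD : IsTailClosed D) (c₀ : Fin 3) (r w : Word)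
    (h : r ++ w ∈ D) :
    Fan (Sum.inr (r ++ w, c₀)) (face w) (vertsOf D ∩ closedInside w) := by
  induction r using List.reverseRecOn generalizing w with
  | nil =>
    have hdf : DirectFan (Sum.inr c₀) Sum.inl fun c =>
        if c = c₀ + 2 then Sum.inr (c₀ + 1) else Sum.inl c := by
      revert c₀; decide
    exact hdf.fan w (fun c => ⟨hD.oct_mem h _, oct_mem_closedInside _ _⟩)
      (fun c => ⟨hD.oct_mem h _, oct_mem_closedInside _ _⟩)
  | append_singleton r τ ih =>
    rw [List.append_assoc, List.singleton_append] at h ⊢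
    have hw : w ∈ D := hD.of_suffix ((List.suffix_cons τ w).trans (List.suffix_append _ _)) h
    obtain ⟨m, t', π, hl, hπ, hs⟩ := exists_link_inl τ
    refine ((ih (τ :: w) h).extend (w := w) hl (fun x hx => eq_childFace_of_oct_mem hx.2) ?_
      (Set.inter_subset_inter_right _ (closedInside_cons_subset τ w))
      (fun c => ⟨hD.oct_mem hw _, oct_mem_closedInside _ _⟩)
      (fun c => ⟨hD.oct_mem hw _, oct_mem_closedInside _ _⟩)).reindex hπ
      (fun c => congrArg (oct w) (hs c))
    intro x hx
    refine eq_childFace_of_oct_mem (w := w) (Or.inl ?_)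
    rw [hx]
    exact List.suffix_append r _

theorem oct_notMem_inside_cons (τ : Option (Fin 3)) (w : Word) (x : Fin 3 ⊕ Fin 3) :
    oct w x ∉ inside (τ :: w) := by
  rcases x with c | c
  · exact fun h => face_notMem_inside w c (inside_cons_subset τ w h)
  · exact cons_not_suffix τ w

theorem disjoint_closedInside_inside {σ τ : Option (Fin 3)} (h : σ ≠ τ) (w : Word) :
    Disjoint (closedInside (σ :: w)) (inside (τ :: w)) := by
  rw [Set.disjoint_left]
  rintro x (hx | ⟨c, rfl⟩) hx'
  · rcases x with c | ⟨p, c⟩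
    · exact hx
    · have := List.suffix_of_suffix_length_le hx hx' (by simp)
      have := this.eq_of_length (by simp)
      simp only [List.cons.injEq, and_true] at this
      exact h this
  · exact oct_notMem_inside_cons τ w _ hx'

theorem exists_cons_suffix {w p : Word} (h : w <:+ p) (hne : p ≠ w) :
    ∃ r σ, p = r ++ σ :: w := by
  obtain ⟨r, rfl⟩ := h
  rcases List.eq_nil_or_concat r with rfl | ⟨r, σ, rfl⟩
  · simp at hne
  · exact ⟨r, σ, by simp⟩

theorem fan_outside {D : Set Word} (hD : IsTailClosed D) {u : Vert} (hu : u ∈ vertsOf D)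
    (w : Word) (hw : w ∈ D) (huw : u ∉ inside w) (huf : ∀ c, face w c ≠ u) :
    Fan u (face w) (vertsOf D \ inside w) := by
  induction w with
  | nil =>
    rcases u with c | ⟨p, c⟩
    · exact (huf c rfl).elim
    · exact (huw (List.nil_suffix)).elim
  | cons τ w ih =>
    have hw' := hD _ _ hw
    have hmem : ∀ x, oct w x ∈ vertsOf D \ inside (τ :: w) := fun x =>
      ⟨hD.oct_mem hw' x, oct_notMem_inside_cons τ w x⟩
    by_cases hr : ∃ v, oct w v = u
    · obtain ⟨v, rfl⟩ := hr
      obtain ⟨m, hm⟩ := exists_directFan (τ := τ) (v := v) fun c h => huf c (by rw [face_cons, h])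
      exact hm.fan w (fun c => hmem _) (fun c => hmem _)
    · by_cases hi : u ∈ inside w
      · rcases u with c | ⟨p, c⟩
        · exact hi.elim
        · obtain ⟨r, σ, rfl⟩ := exists_cons_suffix hi fun h => hr ⟨Sum.inr c, h ▸ rfl⟩
          have hστ : σ ≠ τ := by
            rintro rfl
            exact huw (List.suffix_append _ _)
          obtain ⟨m, t', π, hl, hπ, hs⟩ := exists_link_sibling hστ
          refine ((fan_inside hD c r (σ :: w) hu).extend (w := w) hl
            (fun x hx => eq_childFace_of_oct_mem hx.2) (fun x hx => (hr ⟨x, hx⟩).elim)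
            ?_ (fun c => hmem _) (fun c => hmem _)).reindex hπ
            (fun c => congrArg (oct w) (hs c))
          exact fun x hx => ⟨hx.1, Set.disjoint_left.1 (disjoint_closedInside_inside hστ w) hx.2⟩
      · obtain ⟨m, t', π, hl, hπ, hs⟩ := exists_link_childFace τ
        refine ((ih hw' hi fun c h => hr ⟨Sum.inl c, h⟩).extend (w := w) hl
            ?_ (fun x hx => (hr ⟨x, hx⟩).elim) ?_ (fun c => hmem _) (fun c => hmem _)).reindex hπ
            (fun c => congrArg (oct w) (hs c))
        · rintro (c | c) hx
          · exact ⟨c, rfl⟩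
          · exact (hx.2 List.suffix_rfl).elim
        · exact fun x hx => ⟨hx.1, fun h => hx.2 (inside_cons_subset τ w h)⟩

theorem EdgeConnected.preimage_val {V : Type} {G : SimpleGraph V} {K B : Set V}
    (h : EdgeConnected G B) (hB : B ⊆ K) :
    EdgeConnected (G.induce K) (Subtype.val ⁻¹' B) := by
  induction h with
  | single v =>
    have : (Subtype.val ⁻¹' {v} : Set K) = {⟨v, hB rfl⟩} := by
      ext x
      simp [Subtype.ext_iff]
    rw [this]
    exact .single _
  | @union A B a b hA hB' ha hb hab ihA ihB =>
    exact (ihA (Set.subset_union_left.trans hB)).union (a := ⟨a, hB (Or.inl ha)⟩)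
      (b := ⟨b, hB (Or.inr hb)⟩) (ihB (Set.subset_union_right.trans hB)) ha hb hab

theorem EdgeConnected.mono {V : Type} {G H : SimpleGraph V} (hGH : G ≤ H) {B : Set V}
    (h : EdgeConnected G B) : EdgeConnected H B := by
  induction h with
  | single v => exact .single v
  | union _ _ ha hb hab ihA ihB => exact ihA.union ihB ha hb (hGH hab)

/-- Adding the edge `uv` creates a `K₅` minor if `u` and `v` are both adjacent to three
disjoint, pairwise adjacent connected sets. -/
theorem not_isPlanar_of_branchSets {V : Type} {G : SimpleGraph V} {K : Set V} {u v : K}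
    (huv : u ≠ v) (X : Fin 3 → Set V) (hX : ∀ c, EdgeConnected G (X c)) (hXK : ∀ c, X c ⊆ K)
    (hd : ∀ c d, c ≠ d → Disjoint (X c) (X d))
    (hadj : ∀ c d, c ≠ d → ∃ x ∈ X c, ∃ y ∈ X d, G.Adj x y)
    (hu : ∀ c, ↑u ∉ X c ∧ ∃ x ∈ X c, G.Adj u x) (hv : ∀ c, ↑v ∉ X c ∧ ∃ x ∈ X c, G.Adj v x) :
    ¬ IsPlanar (G.induce K ⊔ SimpleGraph.fromEdgeSet {s(u, v)}) := by
  rintro ⟨E⟩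
  have hle : G.induce K ≤ G.induce K ⊔ SimpleGraph.fromEdgeSet {s(u, v)} := le_sup_left
  refine E.not_complete_five_minor
    (Fin.cons {u} (Fin.cons {v} fun c => Subtype.val ⁻¹' X c)) ?_ ?_ ?_
  · refine Fin.cases (.single u) (Fin.cases (.single v) fun c => ?_)
    exact ((hX c).preimage_val (hXK c)).mono hle
  · refine Fin.cases ?_ (Fin.cases ?_ fun c => ?_) <;>
      refine Fin.cases ?_ (Fin.cases ?_ fun d => ?_) <;> intro h
    · exact absurd h (lt_irrefl _)
    · simpa using huv
    · simpa using (hu d).1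
    · exact absurd h (by decide)
    · exact absurd h (lt_irrefl _)
    · simpa using (hv d).1
    · exact absurd h (by simp)
    · exact absurd h (by simp [Fin.lt_def])
    · exact (hd c d (by rintro rfl; exact absurd h (lt_irrefl _))).preimage _
  · refine Fin.cases ?_ (Fin.cases ?_ fun c => ?_) <;>
      refine Fin.cases ?_ (Fin.cases ?_ fun d => ?_) <;> intro h
    · exact absurd h (lt_irrefl _)
    · exact ⟨u, rfl, v, rfl, Or.inr (by simpa using huv)⟩
    · obtain ⟨-, x, hx, hux⟩ := hu d
      exact ⟨u, rfl, ⟨x, hXK d hx⟩, hx, Or.inl hux⟩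
    · exact absurd h (by decide)
    · exact absurd h (lt_irrefl _)
    · obtain ⟨-, x, hx, hux⟩ := hv d
      exact ⟨v, rfl, ⟨x, hXK d hx⟩, hx, Or.inl hux⟩
    · exact absurd h (by simp)
    · exact absurd h (by simp [Fin.lt_def])
    · obtain ⟨x, hx, y, hy, hxy⟩ := hadj c d (by rintro rfl; exact absurd h (lt_irrefl _))
      exact ⟨⟨x, hXK c hx⟩, hx, ⟨y, hXK d hy⟩, hy, Or.inl hxy⟩

theorem not_isPlanar_sup_of_notMem_inside {D : Set Word} (hD : IsTailClosed D)
    {u v : vertsOf D} {q : Word} {c₀ : Fin 3} (hv : (v : Vert) = Sum.inr (q, c₀))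
    (hu : (u : Vert) ∉ inside q) (hadj : ¬ nested.Adj u v) :
    ¬ IsPlanar (nested.induce (vertsOf D) ⊔ SimpleGraph.fromEdgeSet {s(u, v)}) := by
  have hq : q ∈ D := by
    have := v.2
    rwa [hv] at this
  have huv : u ≠ v := by
    rintro rfl
    rw [hv] at hu
    exact hu List.suffix_rfl
  have hvo : (v : Vert) = oct q (Sum.inr c₀) := hv
  by_cases huf : ∃ c, face q c = u
  · obtain ⟨c, hc⟩ := huf
    obtain rfl : c = c₀ + 2 := by
      by_contra h
      refine hadj ?_
      rw [hv, ← hc]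
      exact (nested_adj_spoke h).symm
    have huo : (u : Vert) = oct q (Sum.inl (c₀ + 2)) := hc.symm
    let t : Fin 3 → Fin 3 ⊕ Fin 3 := ![Sum.inl c₀, Sum.inl (c₀ + 1), Sum.inr (c₀ + 2)]
    let m : Fin 3 → Fin 3 ⊕ Fin 3 := ![Sum.inl c₀, Sum.inr (c₀ + 1), Sum.inr (c₀ + 2)]
    obtain ⟨X, hX, hd⟩ : ∃ X : Fin 3 → Set Vert, (∀ c, X c = {oct q (t c)} ∪ {oct q (m c)}) ∧
      ∀ c d, c ≠ d → Disjoint (X c) (X d) := by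
      refine ⟨_, fun c => rfl, fun c d hcd => ?_⟩
      have h : t c ≠ t d ∧ t c ≠ m d ∧ m c ≠ t d ∧ m c ≠ m d := by
        simp only [t, m]
        clear * - hcd
        revert c₀ c d
        decide
      simp [(oct_injective q).eq_iff, h.1.symm, h.2.1.symm, h.2.2.1.symm, h.2.2.2.symm]
    have htX : ∀ c, oct q (t c) ∈ X c := fun c => by simp [hX]
    have hmX : ∀ c, oct q (m c) ∈ X c := fun c => by simp [hX]
    refine not_isPlanar_of_branchSets huv X (fun c => ?_) (fun c => ?_) hd (fun c d hcd => ?_)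
      (fun c => ⟨?_, oct q (t c), htX c, ?_⟩) (fun c => ⟨?_, oct q (t c), htX c, ?_⟩)
    · rw [hX]
      refine edgeConnected_union_singleton (.single _) rfl ?_
      have h : m c = t c ∨ octAdj (t c) (m c) = true := by
        simp only [t, m]; clear * -; revert c₀ c; decide
      exact h.imp (congrArg _) nested_adj_oct
    · rw [hX]
      rintro _ (rfl | rfl) <;> exact hD.oct_mem hq _
    · have h : octAdj (t c) (t d) = true ∨ octAdj (m c) (m d) = true := by
        simp only [t, m]; clear * - hcd; revert c₀ c d; decide
      rcases h with h | h
      · exact ⟨_, htX c, _, htX d, nested_adj_oct h⟩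
      · exact ⟨_, hmX c, _, hmX d, nested_adj_oct h⟩
    · have h : Sum.inl (c₀ + 2) ≠ t c ∧ Sum.inl (c₀ + 2) ≠ m c := by
        simp only [t, m]; clear * -; revert c₀ c; decide
      simp [hX, huo, (oct_injective q).eq_iff, h, - oct_inl]
    · rw [huo]
      refine nested_adj_oct ?_
      simp only [t]; clear * -; revert c₀ c; decide
    · have h : Sum.inr c₀ ≠ t c ∧ Sum.inr c₀ ≠ m c := by
        simp only [t, m]; clear * -; revert c₀ c; decide
      simp [hX, hvo, (oct_injective q).eq_iff, h, - oct_inr]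
    · rw [hvo]
      refine nested_adj_oct ?_
      simp only [t]; clear * -; revert c₀ c; decide
  · obtain ⟨X, hX, hd⟩ := fan_outside hD u.2 q hq hu fun c h => huf ⟨c, h⟩
    have hin : ∀ c d, (Sum.inr (q, d) : Vert) ∉ X c := fun c d h =>
      ((hX c).2.2.1 h).2 List.suffix_rfl
    let s : Fin 3 → Set Vert := fun c => if c = c₀ + 2 then {Sum.inr (q, c₀ + 1)} else ∅
    have hs : ∀ c x, x ∈ s c ↔ c = c₀ + 2 ∧ x = Sum.inr (q, c₀ + 1) := by
      intro c x
      by_cases h : c = c₀ + 2 <;> simp [s, h]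
    refine not_isPlanar_of_branchSets huv (fun c => X c ∪ s c) (fun c => ?_) (fun c => ?_)
      (fun c d hcd => ?_) (fun c d hcd => ?_) (fun c => ⟨?_, ?_⟩) (fun c => ⟨?_, ?_⟩)
    · by_cases h : c = c₀ + 2
      · have : s c = {Sum.inr (q, c₀ + 1)} := by simp [s, h]
        rw [this]
        refine (hX c).1.union (.single _) (hX c).2.1 rfl (nested_adj_spoke ?_).symm
        rw [h]
        clear * -
        revert c₀
        decide
      · simpa [s, h] using (hX c).1
    · rintro x (hx | hx)
      · exact ((hX c).2.2.1 hx).1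
      · rw [((hs _ _).1 hx).2]
        exact hq
    · rw [Set.disjoint_left]
      rintro x (hx | hx) (hx' | hx')
      · exact Set.disjoint_left.1 (hd c d hcd) hx hx'
      · rw [((hs _ _).1 hx').2] at hx
        exact hin _ _ hx
      · rw [((hs _ _).1 hx).2] at hx'
        exact hin _ _ hx'
      · exact hcd (((hs _ _).1 hx).1.trans ((hs _ _).1 hx').1.symm)
    · exact ⟨_, Or.inl (hX c).2.1, _, Or.inl (hX d).2.1, nested_adj_face hcd⟩
    · rintro (h | h)
      · exact (hX c).2.2.2.1 h
      · rw [((hs _ _).1 h).2] at hu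
        exact hu List.suffix_rfl
    · obtain ⟨x, hx, hux⟩ := (hX c).2.2.2.2
      exact ⟨x, Or.inl hx, hux⟩
    · rw [hv]
      rintro (h | h)
      · exact hin _ _ h
      · have := ((hs _ _).1 h).2
        simp at this
    · rw [hv]
      by_cases h : c = c₀ + 2
      · exact ⟨_, Or.inr ((hs _ _).2 ⟨h, rfl⟩), nested_adj_inr (by simp)⟩
      · exact ⟨_, Or.inl (hX c).2.1, nested_adj_spoke h⟩

/-- The nested octahedra with octWords in `D` form an edge-maximal planar graph, as soon as they
form a planar one. -/
theorem nested_not_isPlanar_sup {D : Set Word} (hD : IsTailClosed D) {u v : vertsOf D}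
    (huv : u ≠ v) (hadj : ¬ (nested.induce (vertsOf D)).Adj u v) :
    ¬ IsPlanar (nested.induce (vertsOf D) ⊔ SimpleGraph.fromEdgeSet {s(u, v)}) := by
  have hadj' : ¬ nested.Adj (u : Vert) v := hadj
  have hne : (u : Vert) ≠ v := fun h => huv (Subtype.ext h)
  have swap : ∀ {p : Word} {c : Fin 3}, (u : Vert) = Sum.inr (p, c) → (v : Vert) ∉ inside p →
      ¬ IsPlanar (nested.induce (vertsOf D) ⊔ SimpleGraph.fromEdgeSet {s(u, v)}) := by
    intro p c hu hv
    rw [Sym2.eq_swap]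
    exact not_isPlanar_sup_of_notMem_inside hD hu hv fun h => hadj' h.symm
  rcases hu : (u : Vert) with a | ⟨p, a⟩ <;> rcases hv : (v : Vert) with b | ⟨q, b⟩
  · rw [hu, hv] at hadj' hne
    exact (hadj' (nested_adj_face (w := []) fun h => hne (congrArg _ h))).elim
  · exact not_isPlanar_sup_of_notMem_inside hD hv (by simp [hu]) hadj'
  · exact swap hu (by simp [hv])
  · by_cases hqp : q <:+ p
    · refine swap hu ?_
      rw [hv, inr_mem_inside]
      intro hpq
      obtain rfl := hpq.eq_of_length_le hqp.length_le
      rw [hu, hv] at hadj' hne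
      exact hadj' (nested_adj_inr fun h => hne (by rw [h]))
    · exact not_isPlanar_sup_of_notMem_inside hD hv (by rw [hu]; exact hqp) hadj'

end Fans

section Coordinates

/-- Barycentric coordinates of the octahedron drawn into the standard triangle. -/
noncomputable def octPt : Fin 3 ⊕ Fin 3 → Fin 3 → ℝ
  | Sum.inl c => fun i => if i = c then 1 else 0
  | Sum.inr c => fun i => if i = c + 2 then 1 / 5 else 2 / 5

/-- The linear map sending the standard triangle onto the triangle `τ` of the octahedron. -/
noncomputable def subMap (τ : Option (Fin 3)) : (Fin 3 → ℝ) →ₗ[ℝ] (Fin 3 → ℝ) :=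
  Fintype.linearCombination ℝ fun c => octPt (childFace τ c)

/-- The linear map sending the standard triangle onto the triangle `w`. -/
noncomputable def triMap : Word → (Fin 3 → ℝ) →ₗ[ℝ] (Fin 3 → ℝ)
  | [] => LinearMap.id
  | τ :: w => triMap w ∘ₗ subMap τ

/-- Barycentric coordinates of the vertices. -/
noncomputable def pos : Vert → Fin 3 → ℝ
  | Sum.inl c => octPt (Sum.inl c)
  | Sum.inr (w, c) => triMap w (octPt (Sum.inr c))

theorem subMap_apply (τ : Option (Fin 3)) (v : Fin 3 → ℝ) (i : Fin 3) :
    subMap τ v i = v 0 * octPt (childFace τ 0) i + v 1 * octPt (childFace τ 1) i +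
      v 2 * octPt (childFace τ 2) i := by
  simp [subMap, Fintype.linearCombination_apply, Fin.sum_univ_three]

theorem subMap_octPt_inl (τ : Option (Fin 3)) (c : Fin 3) :
    subMap τ (octPt (Sum.inl c)) = octPt (childFace τ c) := by
  have : octPt (Sum.inl c) = Pi.single c 1 := by
    ext i
    simp [octPt, Pi.single_apply]
  rw [this, subMap, Fintype.linearCombination_apply_single, one_smul]

theorem pos_oct (w : Word) (x : Fin 3 ⊕ Fin 3) : pos (oct w x) = triMap w (octPt x) := by
  induction w generalizing x with
  | nil => rcases x with c | c <;> rfl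
  | cons τ w ih =>
    rcases x with c | c
    · rw [oct_inl, face_cons, ih, triMap, LinearMap.comp_apply, subMap_octPt_inl]
    · rfl

theorem sum_octPt (x : Fin 3 ⊕ Fin 3) : octPt x 0 + octPt x 1 + octPt x 2 = 1 := by
  rcases x with c | c <;> fin_cases c <;> simp [octPt] <;> norm_num

theorem sum_subMap (τ : Option (Fin 3)) (v : Fin 3 → ℝ) :
    subMap τ v 0 + subMap τ v 1 + subMap τ v 2 = v 0 + v 1 + v 2 := by
  simp only [subMap_apply]
  linear_combination v 0 * sum_octPt (childFace τ 0) + v 1 * sum_octPt (childFace τ 1) +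
    v 2 * sum_octPt (childFace τ 2)

theorem sum_triMap (w : Word) (v : Fin 3 → ℝ) :
    triMap w v 0 + triMap w v 1 + triMap w v 2 = v 0 + v 1 + v 2 := by
  induction w generalizing v with
  | nil => rfl
  | cons τ w ih => rw [triMap, LinearMap.comp_apply, ih, sum_subMap]

theorem octPt_nonneg (x : Fin 3 ⊕ Fin 3) (i : Fin 3) : 0 ≤ octPt x i := by
  rcases x with c | c <;> simp only [octPt] <;> split_ifs <;> norm_num

theorem subMap_pos {τ : Option (Fin 3)} {v : Fin 3 → ℝ} (hv : ∀ i, 0 < v i) (i : Fin 3) :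
    0 < subMap τ v i := by
  rw [subMap_apply]
  have h0 := hv 0
  have h1 := hv 1
  have h2 := hv 2
  rcases τ with _ | j
  · simp only [childFace, octPt]
    split_ifs <;> positivity
  · fin_cases j <;> fin_cases i <;> simp [childFace, octPt] <;> positivity

theorem subMap_injective (τ : Option (Fin 3)) : Function.Injective (subMap τ) := by
  intro v v' h
  have h0 := congrFun h 0
  have h1 := congrFun h 1
  have h2 := congrFun h 2
  simp only [subMap_apply] at h0 h1 h2
  ext i
  rcases τ with _ | j
  · simp [childFace, octPt] at h0 h1 h2
    fin_cases i <;> simp <;> linarith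
  · fin_cases j <;> simp [childFace, octPt] at h0 h1 h2 <;> fin_cases i <;> simp <;> linarith

theorem triMap_injective (w : Word) : Function.Injective (triMap w) := by
  induction w with
  | nil => exact Function.injective_id
  | cons τ w ih => exact ih.comp (subMap_injective τ)

/-- Distinct triangles of the octahedron have disjoint interiors. -/
theorem subMap_ne_subMap {σ τ : Option (Fin 3)} (h : σ ≠ τ) {v v' : Fin 3 → ℝ}
    (hv : ∀ i, 0 < v i) (hv' : ∀ i, 0 < v' i) : subMap σ v ≠ subMap τ v' := by
  intro he
  have h0 := congrFun he 0
  have h1 := congrFun he 1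
  have h2 := congrFun he 2
  have a0 := hv 0
  have a1 := hv 1
  have a2 := hv 2
  have b0 := hv' 0
  have b1 := hv' 1
  have b2 := hv' 2
  simp only [subMap_apply] at h0 h1 h2
  rcases σ with _ | i <;> rcases τ with _ | j
  · exact h rfl
  · fin_cases j <;> simp [childFace, octPt] at h0 h1 h2 <;> linarith
  · fin_cases i <;> simp [childFace, octPt] at h0 h1 h2 <;> linarith
  · fin_cases i <;> fin_cases j <;> first | exact h rfl | skip
    all_goals simp [childFace, octPt] at h0 h1 h2
    all_goals linarith

/-- The edges of the octahedron avoid the interiors of its triangles. -/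
theorem subMap_ne_edge {τ : Option (Fin 3)} {v : Fin 3 → ℝ} (hv : ∀ i, 0 < v i)
    {x y : Fin 3 ⊕ Fin 3} (hxy : octAdj x y = true) {a b : ℝ} (ha : 0 ≤ a) (hb : 0 ≤ b)
    (hab : a + b = 1) : subMap τ v ≠ a • octPt x + b • octPt y := by
  intro he
  have h0 := congrFun he 0
  have h1 := congrFun he 1
  have h2 := congrFun he 2
  have a0 := hv 0
  have a1 := hv 1
  have a2 := hv 2
  simp only [subMap_apply, Pi.add_apply, Pi.smul_apply, smul_eq_mul] at h0 h1 h2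
  clear he hv
  rcases τ with _ | j
  · rcases x with c | c <;> rcases y with d | d <;> fin_cases c <;> fin_cases d <;>
      first | exact absurd hxy (by decide) | skip
    all_goals simp [childFace, octPt] at h0 h1 h2
    all_goals linarith
  · rcases x with c | c <;> rcases y with d | d <;> fin_cases c <;> fin_cases d <;>
      first | exact absurd hxy (by decide) | skip
    all_goals fin_cases j <;> simp [childFace, octPt] at h0 h1 h2
    all_goals linarith

end Coordinates

section OctahedronEdges

/-- Five times the barycentric coordinates of the octahedron. -/
def octInt : Fin 3 ⊕ Fin 3 → Fin 3 → ℤ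
  | Sum.inl c => fun i => if i = c then 5 else 0
  | Sum.inr c => fun i => if i = c + 2 then 1 else 2

theorem octInt_eq (x : Fin 3 ⊕ Fin 3) (i : Fin 3) : (octInt x i : ℝ) = 5 * octPt x i := by
  rcases x with c | c <;> simp only [octInt, octPt] <;> split_ifs <;> norm_num

theorem octInt_det_ne_zero : ∀ x y z : Fin 3 ⊕ Fin 3, x ≠ y → x ≠ z → y ≠ z →
    octInt y 0 * (octInt x 1 * octInt z 2 - octInt x 2 * octInt z 1) +
    octInt y 1 * (octInt x 2 * octInt z 0 - octInt x 0 * octInt z 2) +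
    octInt y 2 * (octInt x 0 * octInt z 1 - octInt x 1 * octInt z 0) ≠ 0 := by decide

/-- Any three vertices of the octahedron are in general position. -/
theorem octPt_independent {x y z : Fin 3 ⊕ Fin 3} (hxy : x ≠ y) (hxz : x ≠ z) (hyz : y ≠ z)
    {a b a' b' : ℝ} (h : a • octPt x + b • octPt y = a' • octPt x + b' • octPt z) :
    b = 0 ∧ b' = 0 := by
  have key : ∀ {y z : Fin 3 ⊕ Fin 3}, x ≠ y → x ≠ z → y ≠ z → ∀ {a b a' b' : ℝ},
      a • octPt x + b • octPt y = a' • octPt x + b' • octPt z → b = 0 := by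
    intro y z hxy hxz hyz a b a' b' h
    have h0 := congrFun h 0
    have h1 := congrFun h 1
    have h2 := congrFun h 2
    simp only [Pi.add_apply, Pi.smul_apply, smul_eq_mul] at h0 h1 h2
    have hdet : ((_ : ℤ) : ℝ) ≠ 0 := Int.cast_ne_zero.2 (octInt_det_ne_zero x y z hxy hxz hyz)
    push_cast [octInt_eq] at hdet
    refine (mul_eq_zero.1 ?_).resolve_right hdet
    linear_combination 125 * (octPt x 1 * octPt z 2 - octPt x 2 * octPt z 1) * h0 +
      125 * (octPt x 2 * octPt z 0 - octPt x 0 * octPt z 2) * h1 +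
      125 * (octPt x 0 * octPt z 1 - octPt x 1 * octPt z 0) * h2
  exact ⟨key hxy hxz hyz h, key hxz hxy hyz.symm h.symm⟩

/-- The edges of the octahedron, listed once each. -/
def octEdge (k : Fin 4) (c : Fin 3) : (Fin 3 ⊕ Fin 3) × (Fin 3 ⊕ Fin 3) :=
  ![(Sum.inl c, Sum.inl (c + 1)), (Sum.inr c, Sum.inr (c + 1)), (Sum.inr c, Sum.inl c),
    (Sum.inr c, Sum.inl (c + 1))] k

theorem exists_octEdge : ∀ x y : Fin 3 ⊕ Fin 3, octAdj x y = true →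
    ∃ k c, octEdge k c = (x, y) ∨ octEdge k c = (y, x) := by decide

theorem octEdge_disjoint {k k' : Fin 4} {c c' : Fin 3}
    (h1 : (octEdge k c).1 ≠ (octEdge k' c').1) (h2 : (octEdge k c).1 ≠ (octEdge k' c').2)
    (h3 : (octEdge k c).2 ≠ (octEdge k' c').1) (h4 : (octEdge k c).2 ≠ (octEdge k' c').2)
    {a b a' b' : ℝ} (ha : 0 ≤ a) (hb : 0 ≤ b) (hab : a + b = 1) (ha' : 0 ≤ a') (hb' : 0 ≤ b')
    (hab' : a' + b' = 1) :
    a • octPt (octEdge k c).1 + b • octPt (octEdge k c).2 ≠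
      a' • octPt (octEdge k' c').1 + b' • octPt (octEdge k' c').2 := by
  intro h
  have e0 := congrFun h 0
  have e1 := congrFun h 1
  have e2 := congrFun h 2
  simp only [Pi.add_apply, Pi.smul_apply, smul_eq_mul] at e0 e1 e2
  clear h
  fin_cases k <;> fin_cases k' <;> fin_cases c <;> fin_cases c' <;>
    first
      | exact absurd (by decide) h1
      | exact absurd (by decide) h2
      | exact absurd (by decide) h3
      | exact absurd (by decide) h4
      | skip
  all_goals simp [octEdge, octPt] at e0 e1 e2
  all_goals linarith

theorem octPt_edge_disjoint {x y x' y' : Fin 3 ⊕ Fin 3} (hxy : octAdj x y = true)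
    (hxy' : octAdj x' y' = true) (h1 : x ≠ x') (h2 : x ≠ y') (h3 : y ≠ x') (h4 : y ≠ y')
    {a b a' b' : ℝ} (ha : 0 ≤ a) (hb : 0 ≤ b) (hab : a + b = 1) (ha' : 0 ≤ a') (hb' : 0 ≤ b')
    (hab' : a' + b' = 1) :
    a • octPt x + b • octPt y ≠ a' • octPt x' + b' • octPt y' := by
  obtain ⟨k, c, hk⟩ := exists_octEdge x y hxy
  obtain ⟨k', c', hk'⟩ := exists_octEdge x' y' hxy'
  have key := @octEdge_disjoint k k' c c'
  rcases hk with hk | hk <;> rcases hk' with hk' | hk' <;> rw [hk, hk'] at key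
  · exact key h1 h2 h3 h4 ha hb hab ha' hb' hab'
  · rw [add_comm (a' • _)]
    exact key h2 h1 h4 h3 ha hb hab hb' ha' (by rwa [add_comm])
  · rw [add_comm (a • _)]
    exact key h3 h4 h1 h2 hb ha (by rwa [add_comm]) ha' hb' hab'
  · rw [add_comm (a • _), add_comm (a' • _)]
    exact key h4 h3 h2 h1 hb ha (by rwa [add_comm]) hb' ha' (by rwa [add_comm])

theorem octAdj_ne : ∀ {x y : Fin 3 ⊕ Fin 3}, octAdj x y = true → x ≠ y := by decide

/-- A vertex on an edge of the octahedron is one of its ends. -/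
theorem octPt_mem_segment {x y z : Fin 3 ⊕ Fin 3} (hxy : octAdj x y = true)
    (h : octPt z ∈ segment ℝ (octPt x) (octPt y)) : z = x ∨ z = y := by
  obtain ⟨a, b, -, -, -, h⟩ := h
  by_contra! hz
  have := (octPt_independent (a' := 0) (b' := 1) (octAdj_ne hxy) hz.1.symm hz.2.symm
    (h.trans (by simp))).2
  exact one_ne_zero this

/-- Two distinct edges of the octahedron meet only in a common end. -/
theorem octPt_segment_inter {x y x' y' : Fin 3 ⊕ Fin 3} (hxy : octAdj x y = true)
    (hxy' : octAdj x' y' = true) (hne : s(x, y) ≠ s(x', y')) {p : Fin 3 → ℝ}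
    (hp : p ∈ segment ℝ (octPt x) (octPt y)) (hp' : p ∈ segment ℝ (octPt x') (octPt y')) :
    p ∈ ({octPt x, octPt y} : Set (Fin 3 → ℝ)) ∩ {octPt x', octPt y'} := by
  have shared : ∀ {x y y' : Fin 3 ⊕ Fin 3}, x ≠ y → x ≠ y' → y ≠ y' →
      p ∈ segment ℝ (octPt x) (octPt y) → p ∈ segment ℝ (octPt x) (octPt y') → p = octPt x := by
    rintro x y y' h1 h2 h3 ⟨a, b, -, -, hab, rfl⟩ ⟨a', b', -, -, -, h⟩
    obtain ⟨rfl, -⟩ := octPt_independent h1 h2 h3 h.symm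
    rw [add_zero] at hab
    simp [hab]
  have hx := octAdj_ne hxy
  have hx' := octAdj_ne hxy'
  rw [Ne, Sym2.eq_iff] at hne
  push Not at hne
  by_cases h1 : x = x'
  · subst h1
    have := shared hx hx' (hne.1 rfl) hp hp'
    simp [this]
  by_cases h2 : x = y'
  · subst h2
    have := shared hx hx'.symm (hne.2 rfl) hp (segment_symm ℝ _ (octPt x) ▸ hp')
    simp [this]
  by_cases h3 : y = x'
  · subst h3
    have := shared hx.symm hx' h2 (segment_symm ℝ _ (octPt y) ▸ hp) hp'
    simp [this]
  by_cases h4 : y = y'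
  · subst h4
    have := shared hx.symm hx'.symm h1 (segment_symm ℝ _ (octPt y) ▸ hp)
      (segment_symm ℝ _ (octPt y) ▸ hp')
    simp [this]
  obtain ⟨a, b, ha, hb, hab, hp⟩ := hp
  obtain ⟨a', b', ha', hb', hab', hp'⟩ := hp'
  exact (octPt_edge_disjoint hxy hxy' h1 h2 h3 h4 ha hb hab ha' hb' hab'
    (hp.trans hp'.symm)).elim

end OctahedronEdges

section Regions

/-- The open triangle with address `w`, as an open cone in barycentric coordinates. -/
def region (w : Word) : Set (Fin 3 → ℝ) := triMap w '' {v | ∀ i, 0 < v i}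

theorem region_cons_subset (τ : Option (Fin 3)) (w : Word) : region (τ :: w) ⊆ region w := by
  rintro _ ⟨v, hv, rfl⟩
  exact ⟨subMap τ v, subMap_pos hv, rfl⟩

theorem region_mono {w p : Word} (h : w <:+ p) : region p ⊆ region w := by
  obtain ⟨r, rfl⟩ := h
  induction r with
  | nil => exact subset_rfl
  | cons τ r ih => exact (region_cons_subset τ _).trans ih

theorem suffix_trichotomy (p w : Word) : p <:+ w ∨ w <:+ p ∨
    ∃ q σ τ, σ ≠ τ ∧ σ :: q <:+ p ∧ τ :: q <:+ w := by
  induction p with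
  | nil => exact Or.inl List.nil_suffix
  | cons σ p ih =>
    rcases ih with h | h | ⟨q, σ', τ, hne, h, h'⟩
    · by_cases hw : w = p
      · exact Or.inr (Or.inl (hw ▸ List.suffix_cons σ w))
      · obtain ⟨r, τ, rfl⟩ := exists_cons_suffix h hw
        by_cases hστ : σ = τ
        · exact Or.inl (hστ ▸ List.suffix_append _ _)
        · exact Or.inr (Or.inr ⟨p, σ, τ, hστ, List.suffix_rfl, List.suffix_append _ _⟩)
    · exact Or.inr (Or.inl (h.trans (List.suffix_cons σ p)))
    · exact Or.inr (Or.inr ⟨q, σ', τ, hne, h.trans (List.suffix_cons σ p), h'⟩)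

theorem region_disjoint {p w q : Word} {σ τ : Option (Fin 3)} (hne : σ ≠ τ) (hp : σ :: q <:+ p)
    (hw : τ :: q <:+ w) : Disjoint (region p) (region w) := by
  refine Disjoint.mono (region_mono hp) (region_mono hw) ?_
  rw [Set.disjoint_left]
  rintro _ ⟨v, hv, rfl⟩ ⟨v', hv', h⟩
  exact subMap_ne_subMap hne hv hv' (triMap_injective q h).symm

theorem octPt_inr_pos (c i : Fin 3) : 0 < octPt (Sum.inr c) i := by
  simp only [octPt]
  split_ifs <;> norm_num

theorem pos_inr_mem_region (q : Word) (c : Fin 3) : pos (Sum.inr (q, c)) ∈ region q :=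
  ⟨_, octPt_inr_pos c, rfl⟩

theorem pos_mem_region {s : Vert} {p : Word} : pos s ∈ region p ↔ s ∈ inside p := by
  rcases s with c | ⟨q, c⟩
  · refine iff_of_false (fun h => ?_) id
    obtain ⟨v, hv, h⟩ := region_mono List.nil_suffix h
    have h' : v = octPt (Sum.inl c) := h
    have := hv (c + 1)
    simp [h', octPt] at this
  · refine ⟨fun h => ?_, fun h => region_mono h (pos_inr_mem_region q c)⟩
    rw [inr_mem_inside]
    rcases suffix_trichotomy p q with h' | h' | ⟨r, σ, τ, hne, h1, h2⟩
    · exact h'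
    · by_cases hpq : p = q
      · exact hpq ▸ List.suffix_rfl
      · obtain ⟨r, τ, rfl⟩ := exists_cons_suffix h' hpq
        obtain ⟨v, hv, hv'⟩ := region_mono (List.suffix_append r (τ :: q)) h
        refine (subMap_ne_edge (τ := τ) (x := Sum.inr c) (y := Sum.inr (c + 1)) (a := 1) (b := 0)
          hv (by simp [octAdj]) zero_le_one le_rfl (by simp) ?_).elim
        simpa using triMap_injective q hv'
    · exact (Set.disjoint_left.1 (region_disjoint hne h1 h2) h (pos_inr_mem_region q c)).elim

theorem octPt_injective : Function.Injective octPt := by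
  have h : ∀ x y, (∀ i, octInt x i = octInt y i) → x = y := by decide
  intro x y hxy
  refine h x y fun i => ?_
  have : (octInt x i : ℝ) = octInt y i := by rw [octInt_eq, octInt_eq, hxy]
  exact_mod_cast this

theorem pos_injective : Function.Injective pos := by
  rintro (c | ⟨q, c⟩) (d | ⟨p, d⟩) h
  · rw [Sum.inl_injective (octPt_injective h)]
  · have h1 : pos (Sum.inl c) ∈ region p := h ▸ pos_inr_mem_region p d
    exact (inl_mem_inside p c (pos_mem_region.1 h1)).elim
  · have h1 : pos (Sum.inl d) ∈ region q := h ▸ pos_inr_mem_region q c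
    exact (inl_mem_inside q d (pos_mem_region.1 h1)).elim
  · have h1 : q <:+ p := pos_mem_region.1 (h ▸ pos_inr_mem_region q c)
    have h2 : p <:+ q := pos_mem_region.1 (h ▸ pos_inr_mem_region p d)
    obtain rfl := h1.eq_of_length_le h2.length_le
    rw [Sum.inr_injective (octPt_injective (triMap_injective q h))]

theorem oct_mem_inside {w p : Word} {x : Fin 3 ⊕ Fin 3} (h : oct w x ∈ inside p) : p <:+ w := by
  have hface : ∀ c, face w c ∈ inside p → p <:+ w := by
    clear h x
    induction w with
    | nil => exact fun c h => h.elim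
    | cons τ w ih =>
      intro c h
      rw [face_cons] at h
      refine List.IsSuffix.trans ?_ (List.suffix_cons τ w)
      generalize childFace τ c = x at h
      rcases x with d | d
      exacts [ih d h, h]
  rcases x with c | c
  exacts [hface c h, h]

theorem mem_segment_pos_oct {w : Word} {x y : Fin 3 ⊕ Fin 3} {z : Fin 3 → ℝ}
    (hz : z ∈ segment ℝ (pos (oct w x)) (pos (oct w y))) :
    ∃ v ∈ segment ℝ (octPt x) (octPt y), triMap w v = z := by
  obtain ⟨a, b, ha, hb, hab, rfl⟩ := hz
  exact ⟨_, ⟨a, b, ha, hb, hab, rfl⟩, by simp [pos_oct]⟩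

theorem mem_region_of_mem_segment {w : Word} {x y : Fin 3 ⊕ Fin 3} {z : Fin 3 → ℝ}
    (hr : x.isRight = true ∨ y.isRight = true)
    (hz : z ∈ segment ℝ (pos (oct w x)) (pos (oct w y))) :
    z ∈ region w ∨ z = pos (oct w x) ∨ z = pos (oct w y) := by
  obtain ⟨a, b, ha, hb, hab, rfl⟩ := hz
  rcases ha.eq_or_lt with rfl | ha
  · right; right
    simp [show b = 1 by linarith]
  rcases hb.eq_or_lt with rfl | hb
  · right; left
    simp [show a = 1 by linarith]
  left
  refine ⟨a • octPt x + b • octPt y, fun i => ?_, by simp [pos_oct]⟩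
  have hx := octPt_nonneg x i
  have hy := octPt_nonneg y i
  simp only [Pi.add_apply, Pi.smul_apply, smul_eq_mul]
  rcases hr with h | h <;> rw [Sum.isRight_iff] at h <;> obtain ⟨c, rfl⟩ := h
  · have := octPt_inr_pos c i
    positivity
  · have := octPt_inr_pos c i
    positivity

theorem notMem_region_of_mem_segment {w p : Word} (hp : ¬ p <:+ w) {x y : Fin 3 ⊕ Fin 3}
    (hxy : octAdj x y = true) (hr : w = [] ∨ x.isRight = true ∨ y.isRight = true) {z : Fin 3 → ℝ}
    (hz : z ∈ segment ℝ (pos (oct w x)) (pos (oct w y))) : z ∉ region p := by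
  intro hzp
  rcases suffix_trichotomy p w with h | h | ⟨r, σ, τ, hne, h1, h2⟩
  · exact hp h
  · obtain ⟨r, τ, rfl⟩ := exists_cons_suffix h (by rintro rfl; exact hp List.suffix_rfl)
    obtain ⟨v, hv, hv'⟩ := region_mono (List.suffix_append r (τ :: w)) hzp
    obtain ⟨v', ⟨a, b, ha, hb, hab, rfl⟩, rfl⟩ := mem_segment_pos_oct hz
    exact subMap_ne_edge hv hxy ha hb hab (triMap_injective w hv')
  · rcases hr with rfl | hr
    · simp at h2
    · rcases mem_region_of_mem_segment hr hz with h | rfl | rfl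
      · exact Set.disjoint_left.1 (region_disjoint hne h1 h2) hzp h
      · exact hp (oct_mem_inside (pos_mem_region.1 hzp))
      · exact hp (oct_mem_inside (pos_mem_region.1 hzp))

theorem exists_oct_of_adj {a b : Vert} (h : nested.Adj a b) :
    ∃ w x y, a = oct w x ∧ b = oct w y ∧ octAdj x y = true ∧
      (w = [] ∨ x.isRight = true ∨ y.isRight = true) := by
  have key : ∀ {a b : Vert}, NestedEdge a b →
      ∃ w x y, a = oct w x ∧ b = oct w y ∧ octAdj x y = true ∧ octAdj y x = true ∧
        (w = [] ∨ x.isRight = true ∨ y.isRight = true) := by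
    rintro _ _ (c | ⟨w, c⟩ | ⟨w, c⟩ | ⟨w, c⟩)
    · exact ⟨[], Sum.inl c, Sum.inl (c + 1), rfl, rfl, by simp [octAdj], by simp [octAdj],
        Or.inl rfl⟩
    · exact ⟨w, Sum.inr c, Sum.inr (c + 1), rfl, rfl, by simp [octAdj], by simp [octAdj],
        Or.inr (Or.inl rfl)⟩
    · exact ⟨w, Sum.inr c, Sum.inl c, rfl, rfl, by simp [octAdj], by simp [octAdj],
        Or.inr (Or.inl rfl)⟩
    · exact ⟨w, Sum.inr c, Sum.inl (c + 1), rfl, rfl, by simp [octAdj], by simp [octAdj],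
        Or.inr (Or.inl rfl)⟩
  rcases h with h | h
  · obtain ⟨w, x, y, h1, h2, h3, -, h4⟩ := key h
    exact ⟨w, x, y, h1, h2, h3, h4⟩
  · obtain ⟨w, x, y, h1, h2, -, h3, h4⟩ := key h
    exact ⟨w, y, x, h2, h1, h3, h4.imp_right Or.symm⟩

/-- A vertex on an edge is one of its ends. -/
theorem pos_mem_segment {a b s : Vert} (h : nested.Adj a b)
    (hs : pos s ∈ segment ℝ (pos a) (pos b)) : s = a ∨ s = b := by
  obtain ⟨w, x, y, rfl, rfl, hxy, hr⟩ := exists_oct_of_adj h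
  by_cases hso : ∃ z, s = oct w z
  · obtain ⟨z, rfl⟩ := hso
    obtain ⟨v, hv, hz⟩ := mem_segment_pos_oct hs
    rw [pos_oct] at hz
    rw [triMap_injective w hz] at hv
    exact (octPt_mem_segment hxy hv).imp (congrArg _) (congrArg _)
  · have hsw : s ∉ inside w := by
      intro hsw
      rcases s with c | ⟨q, c⟩
      · exact hsw
      · refine notMem_region_of_mem_segment (p := q) ?_ hxy hr hs (pos_inr_mem_region q c)
        intro hqw
        obtain rfl := hqw.eq_of_length_le (List.IsSuffix.length_le hsw)
        exact hso ⟨Sum.inr c, rfl⟩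
    have hr' : x.isRight = true ∨ y.isRight = true := by
      refine hr.resolve_left ?_
      rintro rfl
      rcases s with c | ⟨q, c⟩
      · exact hso ⟨Sum.inl c, rfl⟩
      · exact hsw List.nil_suffix
    rcases mem_region_of_mem_segment hr' hs with h | h | h
    · exact (hsw (pos_mem_region.1 h)).elim
    · exact Or.inl (pos_injective h)
    · exact Or.inr (pos_injective h)

/-- Two distinct edges meet only in a common end. -/
theorem segment_pos_inter {a b c d : Vert} (h : nested.Adj a b) (h' : nested.Adj c d)
    (hne : s(a, b) ≠ s(c, d)) {z : Fin 3 → ℝ} (hz : z ∈ segment ℝ (pos a) (pos b))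
    (hz' : z ∈ segment ℝ (pos c) (pos d)) : (z = pos a ∨ z = pos b) ∧ (z = pos c ∨ z = pos d) := by
  have key : ∀ {a b c d : Vert} {w p : Word} {x y x' y' : Fin 3 ⊕ Fin 3}, nested.Adj c d →
      a = oct w x → b = oct w y → c = oct p x' → d = oct p y' → octAdj x' y' = true →
      (w = [] ∨ x.isRight = true ∨ y.isRight = true) →
      (p = [] ∨ x'.isRight = true ∨ y'.isRight = true) → ¬ w <:+ p →
      z ∈ segment ℝ (pos a) (pos b) → z ∈ segment ℝ (pos c) (pos d) →
      (z = pos a ∨ z = pos b) ∧ (z = pos c ∨ z = pos d) := by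
    rintro a b c d w p x y x' y' h' rfl rfl rfl rfl hxy' hr hr' hwp hz hz'
    have hr : x.isRight = true ∨ y.isRight = true := by
      refine hr.resolve_left ?_
      rintro rfl
      exact hwp List.nil_suffix
    have hz2 := (mem_region_of_mem_segment hr hz).resolve_left
      (notMem_region_of_mem_segment hwp hxy' hr' hz')
    refine ⟨hz2, ?_⟩
    rcases hz2 with rfl | rfl <;>
      exact (pos_mem_segment h' hz').imp (congrArg _) (congrArg _)
  obtain ⟨w, x, y, ha, hb, hxy, hr⟩ := exists_oct_of_adj h
  obtain ⟨p, x', y', hc, hd, hxy', hr'⟩ := exists_oct_of_adj h'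
  by_cases hwp : w <:+ p
  · by_cases hpw : p <:+ w
    · obtain rfl := hwp.eq_of_length_le hpw.length_le
      subst ha hb hc hd
      obtain ⟨v, hv, rfl⟩ := mem_segment_pos_oct hz
      obtain ⟨v', hv', hvv⟩ := mem_segment_pos_oct hz'
      obtain rfl := triMap_injective _ hvv
      have := octPt_segment_inter hxy hxy' (fun h => hne (by
        simpa using congrArg (Sym2.map (oct w)) h)) hv hv'
      simp only [Set.mem_inter_iff, Set.mem_insert_iff, Set.mem_singleton_iff] at this
      simp only [pos_oct]
      exact this.imp (Or.imp (congrArg _) (congrArg _)) (Or.imp (congrArg _) (congrArg _))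
    · exact (key h hc hd ha hb hxy hr' hr hpw hz' hz).symm
  · exact key h' ha hb hc hd hxy' hr hr' hwp hz hz'

end Regions

section Embedding

/-- Barycentric coordinates of a point of the plane. -/
def bary (p : ℝ × ℝ) : Fin 3 → ℝ := ![1 - p.1 - p.2, p.1, p.2]

/-- The position of a vertex in the plane. -/
noncomputable def pt (s : Vert) : ℝ × ℝ := (pos s 1, pos s 2)

theorem continuous_bary : Continuous bary := by
  refine continuous_pi fun i => ?_
  fin_cases i <;> simp [bary] <;> fun_prop

theorem bary_injective : Function.Injective bary := fun _ _ h =>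
  Prod.ext (congrFun h 1) (congrFun h 2)

theorem sum_bary (p : ℝ × ℝ) : bary p 0 + bary p 1 + bary p 2 = 1 := by
  simp [bary]
  ring

theorem sum_pos (s : Vert) : pos s 0 + pos s 1 + pos s 2 = 1 := by
  rcases s with c | ⟨w, c⟩
  · exact sum_octPt (Sum.inl c)
  · exact (sum_triMap w _).trans (sum_octPt _)

theorem eq_bary {v : Fin 3 → ℝ} (h : v 0 + v 1 + v 2 = 1) : v = bary (v 1, v 2) := by
  ext i
  fin_cases i <;> simp [bary]
  linarith

theorem bary_pt (s : Vert) : bary (pt s) = pos s := (eq_bary (sum_pos s)).symm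

theorem bary_mem_segment {p q z : ℝ × ℝ} :
    bary z ∈ segment ℝ (bary p) (bary q) ↔ z ∈ segment ℝ p q := by
  have key : ∀ a b : ℝ, a + b = 1 → a • bary p + b • bary q = bary (a • p + b • q) := by
    intro a b hab
    ext i
    fin_cases i <;> simp [bary]
    linear_combination hab
  constructor
  · rintro ⟨a, b, ha, hb, hab, h⟩
    exact ⟨a, b, ha, hb, hab, bary_injective ((key a b hab).symm.trans h)⟩
  · rintro ⟨a, b, ha, hb, hab, rfl⟩
    exact ⟨a, b, ha, hb, hab, key a b hab⟩

theorem mem_segment_pt {a b : Vert} {z : ℝ × ℝ} :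
    z ∈ segment ℝ (pt a) (pt b) ↔ bary z ∈ segment ℝ (pos a) (pos b) := by
  rw [← bary_mem_segment, bary_pt, bary_pt]

theorem pt_injective : Function.Injective pt := fun a b h =>
  pos_injective (by rw [← bary_pt, ← bary_pt, h])

theorem pt_mem_segment {a b s : Vert} (h : nested.Adj a b)
    (hs : pt s ∈ segment ℝ (pt a) (pt b)) : s = a ∨ s = b := by
  rw [mem_segment_pt, bary_pt] at hs
  exact pos_mem_segment h hs

theorem segment_pt_inter {a b c d : Vert} (h : nested.Adj a b) (h' : nested.Adj c d)
    (hne : s(a, b) ≠ s(c, d)) {z : ℝ × ℝ} (hz : z ∈ segment ℝ (pt a) (pt b))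
    (hz' : z ∈ segment ℝ (pt c) (pt d)) : (z = pt a ∨ z = pt b) ∧ (z = pt c ∨ z = pt d) := by
  rw [mem_segment_pt] at hz hz'
  have := segment_pos_inter h h' hne hz hz'
  simpa only [← bary_pt, bary_injective.eq_iff] using this

/-- The straight-line drawing of the nested octahedra, restricted to a set of vertices. -/
noncomputable def drawing (K : Set Vert) : PlaneEmbedding (nested.induce K) where
  vtx v := pt v
  vtx_inj := pt_injective.comp Subtype.val_injective
  arc u v _ := segment ℝ (pt u) (pt v)
  arc_symm _ _ _ := segment_symm ℝ _ _
  arc_path u v h := ⟨Path.segment _ _,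
    Path.segment_injective_of_ne (pt_injective.ne (SimpleGraph.Adj.ne (G := nested) h)),
    Path.range_segment _ _⟩
  arc_vtx u v h w hw := (pt_mem_segment h hw).imp Subtype.ext Subtype.ext
  arc_inter u v a b h₁ h₂ hne := by
    rintro z ⟨hz, hz'⟩
    refine segment_pt_inter h₁ h₂ (fun h => hne ?_) hz hz'
    exact Sym2.map.injective Subtype.val_injective (by simpa using h)

/-- The point set of the straight-line drawing of the subgraph induced on `T`. -/
def skeleton (T : Set Vert) : Set (ℝ × ℝ) :=
  pt '' T ∪ {z | ∃ u ∈ T, ∃ v ∈ T, nested.Adj u v ∧ z ∈ segment ℝ (pt u) (pt v)}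

/-- The straight-line drawing of the subgraph induced on `T` is outerplane. -/
def OuterplaneSet (T : Set Vert) : Prop :=
  ∀ v ∈ T, pt v ∈ closure {p | p ∉ skeleton T ∧
    ¬ Bornology.IsBounded (connectedComponentIn (skeleton T)ᶜ p)}

theorem drawing_subSupport {K : Set Vert} (S : Set K) :
    (drawing K).subSupport S = skeleton (Subtype.val '' S) := by
  rw [PlaneEmbedding.subSupport, skeleton, Set.image_image]
  congr 1
  ext z
  simp only [Set.mem_iUnion, Set.mem_ofPred_eq]
  constructor
  · rintro ⟨u, hu, v, hv, h, hz⟩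
    exact ⟨u, ⟨u, hu, rfl⟩, v, ⟨v, hv, rfl⟩, h, hz⟩
  · rintro ⟨_, ⟨u, hu, rfl⟩, _, ⟨v, hv, rfl⟩, h, hz⟩
    exact ⟨u, hu, v, hv, h, hz⟩

theorem drawing_outerplaneOn {K : Set Vert} (S : Set K) :
    (drawing K).OuterplaneOn S ↔ OuterplaneSet (Subtype.val '' S) := by
  rw [PlaneEmbedding.OuterplaneOn, OuterplaneSet, drawing_subSupport, Set.forall_mem_image]
  rfl

end Embedding

section Barriers

/-- A bounded open set whose frontier is drawn separates the vertices inside from the outer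
face. -/
theorem OuterplaneSet.notMem_of_barrier {T : Set Vert} (hT : OuterplaneSet T) {U : Set (ℝ × ℝ)}
    (hU : IsOpen U) (hb : Bornology.IsBounded U) (hf : frontier U ⊆ skeleton T) {v : Vert}
    (hv : pt v ∈ U) : v ∉ T := by
  intro hvT
  obtain ⟨p, hpU, hp, hpb⟩ := mem_closure_iff.1 (hT v hvT) U hU hv
  refine hpb (hb.subset ?_)
  refine isPreconnected_connectedComponentIn.subset_left_of_subset_union hU
    isClosed_closure.isOpen_compl
    (Set.disjoint_left.2 fun q hq hq' => hq' (subset_closure hq)) ?_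
    ⟨p, mem_connectedComponentIn hp, hpU⟩
  intro q hq
  by_contra hqn
  rw [Set.mem_union, not_or, Set.mem_compl_iff, not_not] at hqn
  refine connectedComponentIn_subset _ _ hq (hf ?_)
  rw [hU.frontier_eq]
  exact ⟨hqn.2, hqn.1⟩

theorem exists_inverse_triMap (w : Word) :
    ∃ g : (Fin 3 → ℝ) → Fin 3 → ℝ, Continuous g ∧ (∀ v, g (triMap w v) = v) ∧
      ∀ v, triMap w (g v) = v := by
  let e := LinearEquiv.ofInjectiveEndo (triMap w) (triMap_injective w)
  refine ⟨e.symm, e.symm.toLinearMap.continuous_of_finiteDimensional,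
    fun v => e.symm_apply_apply v, fun v => e.apply_symm_apply v⟩

/-- A convex combination of two octahedron vertices is drawn on their common edge. -/
theorem mem_skeleton_of_combination {T : Set Vert} {w : Word} {x y : Fin 3 ⊕ Fin 3}
    (hx : oct w x ∈ T) (hy : oct w y ∈ T) (hxy : nested.Adj (oct w x) (oct w y)) {p : ℝ × ℝ}
    {a b : ℝ} (ha : 0 ≤ a) (hb : 0 ≤ b) (hab : a + b = 1)
    (hp : bary p = triMap w (a • octPt x + b • octPt y)) : p ∈ skeleton T := by
  refine Or.inr ⟨_, hx, _, hy, hxy, ?_⟩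
  rw [mem_segment_pt]
  exact ⟨a, b, ha, hb, hab, by simp [hp, pos_oct]⟩

theorem triMap_nonneg {w : Word} {v : Fin 3 → ℝ} (hv : ∀ i, 0 ≤ v i) (i : Fin 3) :
    0 ≤ triMap w v i := by
  induction w generalizing v i with
  | nil => exact hv i
  | cons τ w ih =>
    refine ih (fun i => ?_) i
    rw [subMap_apply]
    have := fun x => mul_nonneg (hv x) (octPt_nonneg (childFace τ x) i)
    linarith [this 0, this 1, this 2]

/-- A barrier given by linear conditions in the coordinates of the triangle `w`. -/
theorem OuterplaneSet.notMem_of_linear_barrier {T : Set Vert} (hT : OuterplaneSet T) (w : Word)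
    {ι : Type} [Finite ι] (f : ι → (Fin 3 → ℝ) → ℝ) (hf : ∀ i, Continuous (f i))
    (hpos : ∀ v : Fin 3 → ℝ, v 0 + v 1 + v 2 = 1 → (∀ i, 0 ≤ f i v) → ∀ j, 0 ≤ v j)
    (hedge : ∀ v : Fin 3 → ℝ, v 0 + v 1 + v 2 = 1 → (∀ i, 0 ≤ f i v) → (∃ i, f i v = 0) →
      ∃ x y, ∃ a b : ℝ, oct w x ∈ T ∧ oct w y ∈ T ∧ octAdj x y = true ∧ 0 ≤ a ∧ 0 ≤ b ∧ a + b = 1 ∧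
        v = a • octPt x + b • octPt y)
    {s : Vert} {u : Fin 3 → ℝ} (hs : pos s = triMap w u) (hu : ∀ i, 0 < f i u) : s ∉ T := by
  obtain ⟨g, hg, hgl, hgr⟩ := exists_inverse_triMap w
  have hgb : Continuous fun p => g (bary p) := hg.comp continuous_bary
  have hsum : ∀ p, g (bary p) 0 + g (bary p) 1 + g (bary p) 2 = 1 := fun p => by
    rw [← sum_triMap w, hgr, sum_bary]
  let U : Set (ℝ × ℝ) := {p | ∀ i, 0 < f i (g (bary p))}
  let C : Set (ℝ × ℝ) := {p | ∀ i, 0 ≤ f i (g (bary p))}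
  have hUC : U ⊆ C := fun p hp i => (hp i).le
  have hUo : IsOpen U := by
    simp only [U, Set.ofPred_forall]
    exact isOpen_iInter_of_finite fun i => isOpen_lt continuous_const ((hf i).comp hgb)
  have hCc : IsClosed C := by
    simp only [C, Set.ofPred_forall]
    exact isClosed_iInter fun i => isClosed_le continuous_const ((hf i).comp hgb)
  refine hT.notMem_of_barrier hUo ?_ ?_ (v := s) ?_
  · refine (Metric.isBounded_Icc (0 : ℝ × ℝ) (1, 1)).subset fun p hp => ?_
    have h := triMap_nonneg (w := w) (hpos _ (hsum p) (hUC hp))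
    simp only [hgr] at h
    have h0 := h 0
    have h1 := h 1
    have h2 := h 2
    simp only [bary, Matrix.cons_val] at h0 h1 h2
    exact ⟨⟨h1, h2⟩, ⟨by dsimp only; linarith, by dsimp only; linarith⟩⟩
  · intro p hp
    rw [hUo.frontier_eq] at hp
    have hpC : p ∈ C := closure_minimal hUC hCc hp.1
    have hp0 : ∃ i, f i (g (bary p)) = 0 := by
      by_contra! hne
      exact hp.2 fun i => (hpC i).lt_of_ne (hne i).symm
    obtain ⟨x, y, a, b, hx, hy, hxy, ha, hb, hab, hv⟩ := hedge _ (hsum p) hpC hp0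
    exact mem_skeleton_of_combination hx hy (nested_adj_oct hxy) ha hb hab (by rw [← hv, hgr])
  · intro i
    rw [bary_pt, hs, hgl]
    exact hu i

theorem OuterplaneSet.notMem_inside {T : Set Vert} (hT : OuterplaneSet T) {w : Word}
    (hw : ∀ c, face w c ∈ T) {s : Vert} (hs : s ∈ inside w) : s ∉ T := by
  obtain ⟨u, hu, hus⟩ := pos_mem_region.2 hs
  refine hT.notMem_of_linear_barrier w (fun i v => v i) continuous_apply (fun v _ h => h) ?_
    hus.symm hu
  rintro v hv hnn ⟨i, hi⟩
  refine ⟨Sum.inl (i + 1), Sum.inl (i + 2), v (i + 1), v (i + 2), hw _, hw _, ?_, hnn _, hnn _,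
    ?_, ?_⟩
  · fin_cases i <;> decide
  · fin_cases i <;> simp at hi ⊢ <;> linarith
  · ext j
    fin_cases i <;> fin_cases j <;> simp [octPt] at hi ⊢ <;> linarith

/-- Two outer and two inner octahedron vertices forming a quadrilateral around the third inner
vertex. -/
theorem OuterplaneSet.notMem_quad {T : Set Vert} (hT : OuterplaneSet T) {w : Word} {c : Fin 3}
    (h0 : face w c ∈ T) (h1 : face w (c + 1) ∈ T) (h2 : Sum.inr (w, c + 1) ∈ T)
    (h3 : Sum.inr (w, c + 2) ∈ T) {s : Vert} {u : Fin 3 → ℝ} (hs : pos s = triMap w u)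
    (hu0 : 0 < u (c + 2)) (hu1 : 3 * u (c + 2) < 2 * (u c + u (c + 1)))
    (hu2 : u (c + 2) < 2 * u c) (hu3 : u (c + 2) < 2 * u (c + 1)) : s ∉ T := by
  refine hT.notMem_of_linear_barrier w
    (![fun v => v (c + 2), fun v => 2 * (v c + v (c + 1)) - 3 * v (c + 2),
      fun v => 2 * v c - v (c + 2), fun v => 2 * v (c + 1) - v (c + 2)] : Fin 4 → _) ?_ ?_ ?_ hs ?_
  · intro i
    fin_cases i <;> simp <;> fun_prop
  · intro v hv h
    have e0 := h 0
    have e1 := h 1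
    have e2 := h 2
    have e3 := h 3
    simp at e0 e1 e2 e3
    intro j
    fin_cases c <;> fin_cases j <;> simp at e0 e1 e2 e3 hv ⊢ <;> linarith
  · rintro v hv h ⟨i, hi⟩
    have e0 := h 0
    have e1 := h 1
    have e2 := h 2
    have e3 := h 3
    simp at e0 e1 e2 e3
    have hsum : v c + v (c + 1) + v (c + 2) = 1 := by
      fin_cases c <;> simp <;> linarith
    have hext : ∀ v' : Fin 3 → ℝ, v c = v' c → v (c + 1) = v' (c + 1) → v (c + 2) = v' (c + 2) →
        v = v' := by
      intro v' a0 a1 a2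
      ext j
      fin_cases c <;> fin_cases j <;> simp at a0 a1 a2 ⊢ <;> assumption
    fin_cases i <;> simp at hi
    · refine ⟨Sum.inl c, Sum.inl (c + 1), v c, v (c + 1), h0, h1, by simp [octAdj], by linarith,
        by linarith, by linarith, hext _ ?_ ?_ ?_⟩
      all_goals clear h h0 h1 h2 h3 hs hu0 hu1 hu2 hu3 hext hv
      all_goals fin_cases c <;> simp [octPt] at hi hsum e2 e3 ⊢ <;> linarith
    · refine ⟨Sum.inr (c + 1), Sum.inr (c + 2), 2 - 5 * v c, 5 * v c - 1, h2, h3, by simp [octAdj],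
        by linarith, by linarith, by ring, hext _ ?_ ?_ ?_⟩
      all_goals clear h h0 h1 h2 h3 hs hu0 hu1 hu2 hu3 hext hv
      all_goals fin_cases c <;> simp [octPt] at hi hsum e2 e3 ⊢ <;> linarith
    · refine ⟨Sum.inl (c + 1), Sum.inr (c + 1), 1 - 5 * v c, 5 * v c, h1, h2, ?_,
        by linarith, by linarith, by ring, hext _ ?_ ?_ ?_⟩
      · exact (by decide : ∀ d : Fin 3, octAdj (Sum.inl (d + 1)) (Sum.inr (d + 1)) = true) c
      all_goals clear h h0 h1 h2 h3 hs hu0 hu1 hu2 hu3 hext hv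
      all_goals fin_cases c <;> simp [octPt] at hi hsum e2 e3 ⊢ <;> linarith
    · refine ⟨Sum.inl c, Sum.inr (c + 2), 1 - 5 * v (c + 1), 5 * v (c + 1), h0, h3, ?_,
        by linarith, by linarith, by ring, hext _ ?_ ?_ ?_⟩
      · exact (by decide : ∀ d : Fin 3, octAdj (Sum.inl d) (Sum.inr (d + 2)) = true) c
      all_goals clear h h0 h1 h2 h3 hs hu0 hu1 hu2 hu3 hext hv
      all_goals fin_cases c <;> simp [octPt] at hi hsum e2 e3 ⊢ <;> linarith
  · intro i
    fin_cases i <;> simp <;> linarith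

theorem OuterplaneSet.inr_notMem_of_quad {T : Set Vert} (hT : OuterplaneSet T) {w : Word}
    {c : Fin 3} (h0 : face w c ∈ T) (h1 : face w (c + 1) ∈ T) (h2 : Sum.inr (w, c + 1) ∈ T)
    (h3 : Sum.inr (w, c + 2) ∈ T) : Sum.inr (w, c) ∉ T := by
  refine hT.notMem_quad h0 h1 h2 h3 rfl ?_ ?_ ?_ ?_ <;> clear h0 h1 h2 h3 <;> fin_cases c <;>
    simp [octPt] <;> norm_num

theorem OuterplaneSet.notMem_side_of_quad {T : Set Vert} (hT : OuterplaneSet T) {w : Word}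
    {c : Fin 3} (h0 : face w c ∈ T) (h1 : face w (c + 1) ∈ T) (h2 : Sum.inr (w, c + 1) ∈ T)
    (h3 : Sum.inr (w, c + 2) ∈ T) {s : Vert} (hs : s ∈ inside (some c :: w)) : s ∉ T := by
  obtain ⟨v, hv, hvs⟩ := pos_mem_region.2 hs
  have a0 := hv 0
  have a1 := hv 1
  have a2 := hv 2
  refine hT.notMem_quad h0 h1 h2 h3 hvs.symm ?_ ?_ ?_ ?_ <;> clear h0 h1 h2 h3 hvs hv <;>
    simp only [subMap_apply] <;> fin_cases c <;> simp [octPt, childFace] <;> linarith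

end Barriers

section Counting

open scoped Classical in
/-- The number of vertices of the family `f` that are missing from `T`. -/
noncomputable def missing {ι : Type} [Fintype ι] (T : Set Vert) (f : ι → Vert) : ℕ :=
  ∑ x, if f x ∈ T then 0 else 1

theorem missing_eq_card {ι : Type} [Fintype ι] {T : Set Vert} {f : ι → Vert}
    (h : ∀ x, f x ∉ T) : missing T f = Fintype.card ι := by
  simp [missing, h]

theorem missing_sum {ι κ : Type} [Fintype ι] [Fintype κ] (T : Set Vert) (f : ι ⊕ κ → Vert) :
    missing T f = missing T (fun x => f (Sum.inl x)) + missing T (fun x => f (Sum.inr x)) := by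
  simp [missing, Fintype.sum_sum_type]

theorem missing_prod {ι κ : Type} [Fintype ι] [Fintype κ] (T : Set Vert) (f : ι × κ → Vert) :
    missing T f = ∑ i, missing T (fun x => f (i, x)) := by
  simp [missing, Fintype.sum_prod_type]

open scoped Classical in
theorem missing_fin_three (T : Set Vert) (f : Fin 3 → Vert) :
    missing T f = ∑ c, (decide (f c ∉ T)).toNat := by
  refine Finset.sum_congr rfl fun c _ => ?_
  by_cases h : f c ∈ T <;> simp [h]

theorem two_le_of_octahedron : ∀ a b : Fin 3 → Bool,
    ((∀ c, ¬ a c) → ∀ c, b c) →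
    (∀ c, ¬ a c → ¬ a (c + 1) → ¬ b (c + 1) → ¬ b (c + 2) → b c) →
    2 ≤ ∑ c, (a c).toNat + ∑ c, (b c).toNat := by
  decide +kernel

set_option synthInstance.maxHeartbeats 200000 in
set_option synthInstance.maxSize 1000 in
theorem three_le_of_block : ∀ a b g : Fin 3 → Bool,
    ((∀ c, ¬ a c) → ∀ c, b c ∧ g c) →
    (∀ c, ¬ a c → ¬ a (c + 1) → ¬ b (c + 1) → ¬ b (c + 2) → b c ∧ g c) →
    (∀ c, ¬ a c → ¬ a (c + 1) → ¬ b c → g c) →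
    3 ≤ ∑ c, (a c).toNat + ∑ c, (b c).toNat + ∑ c, 4 * (g c).toNat ∨
      2 ≤ ∑ c, (a c).toNat ∧ ∀ c, ¬ b c := by
  decide +kernel

/-- At least two vertices of every octahedron are missing from an outerplane set. -/
theorem OuterplaneSet.two_le_missing_oct {T : Set Vert} (hT : OuterplaneSet T) (w : Word) :
    2 ≤ missing T (face w) + missing T (fun c => Sum.inr (w, c)) := by
  classical
  rw [missing_fin_three, missing_fin_three]
  refine two_le_of_octahedron _ _ ?_ ?_
  · simp only [decide_eq_true_eq, not_not]
    exact fun h c => hT.notMem_inside h List.suffix_rfl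
  · simp only [decide_eq_true_eq, not_not]
    exact fun c h0 h1 h2 h3 => hT.inr_notMem_of_quad h0 h1 h2 h3

/-- The vertices of the octahedra in the triangle `w` and in its central triangle. -/
def gadget (w : Word) : Fin 3 ⊕ Fin 3 → Vert :=
  Sum.elim (fun c => Sum.inr (w, c)) (fun c => Sum.inr (none :: w, c))

theorem gadget_mem_inside (w : Word) (x : Fin 3 ⊕ Fin 3) : gadget w x ∈ inside w := by
  rcases x with c | c
  exacts [List.suffix_rfl, List.suffix_cons none w]

theorem OuterplaneSet.two_le_missing_gadget {T : Set Vert} (hT : OuterplaneSet T) (w : Word) :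
    2 ≤ missing T (gadget w) := by
  rw [missing_sum]
  exact hT.two_le_missing_oct (none :: w)

/-- The octahedron in the triangle `w` together with the gadgets in its side triangles. -/
def block (w : Word) : (Fin 3 ⊕ Fin 3) ⊕ Fin 3 × (Fin 3 ⊕ Fin 3) → Vert :=
  Sum.elim (oct w) fun p => gadget (some p.1 :: w) p.2

theorem missing_block (T : Set Vert) (w : Word) :
    missing T (block w) = missing T (face w) + missing T (fun c => Sum.inr (w, c)) +
      ∑ j, missing T (gadget (some j :: w)) := by
  rw [missing_sum, missing_sum, missing_prod]
  rfl

theorem OuterplaneSet.eight_le_missing_block {T : Set Vert} (hT : OuterplaneSet T) (w : Word) :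
    9 ≤ missing T (block w) ∨ 8 ≤ missing T (block w) ∧ ∀ c, Sum.inr (w, c) ∈ T := by
  classical
  have hg : ∀ j, 2 + 4 * (decide (∀ x, gadget (some j :: w) x ∉ T)).toNat ≤
      missing T (gadget (some j :: w)) := by
    intro j
    by_cases h : ∀ x, gadget (some j :: w) x ∉ T
    · rw [missing_eq_card h, decide_eq_true h]
      simp
    · rw [decide_eq_false h]
      exact hT.two_le_missing_gadget (some j :: w)
  have hsum := Finset.sum_le_sum fun j (_ : j ∈ Finset.univ) => hg j
  rw [Finset.sum_add_distrib] at hsum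
  simp only [Finset.sum_const, Finset.card_univ, Fintype.card_fin, smul_eq_mul] at hsum
  rw [missing_block, missing_fin_three, missing_fin_three]
  have key := three_le_of_block (fun c => decide (face w c ∉ T))
    (fun c => decide (Sum.inr (w, c) ∉ T)) (fun j => decide (∀ x, gadget (some j :: w) x ∉ T))
    ?_ ?_ ?_
  · rcases key with key | ⟨key, hb⟩
    · left
      omega
    · right
      refine ⟨by omega, fun c => ?_⟩
      simpa using hb c
  · simp only [decide_eq_true_eq, not_not]
    exact fun h c => ⟨hT.notMem_inside h List.suffix_rfl, fun x =>
      hT.notMem_inside h (inside_cons_subset _ _ (gadget_mem_inside _ x))⟩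
  · simp only [decide_eq_true_eq, not_not]
    exact fun c h0 h1 h2 h3 => ⟨hT.inr_notMem_of_quad h0 h1 h2 h3, fun x =>
      hT.notMem_side_of_quad h0 h1 h2 h3 (gadget_mem_inside _ x)⟩
  · simp only [decide_eq_true_eq, not_not]
    refine fun c h0 h1 h2 x => hT.notMem_inside (fun d => ?_) (gadget_mem_inside _ x)
    fin_cases d
    exacts [h0, h1, h2]

/-- If the inner octahedron vertices of the triangle `w` are present, then the next block is
missing. -/
theorem OuterplaneSet.ten_le_missing_block {T : Set Vert} (hT : OuterplaneSet T) {w : Word}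
    (hw : ∀ c, Sum.inr (w, c) ∈ T) : 10 ≤ missing T (block (none :: none :: w)) := by
  have h := fun s hs => hT.notMem_inside (w := none :: w) hw (s := s) hs
  rw [missing_block, missing_eq_card (f := face (none :: none :: w)), missing_eq_card]
  · have := Finset.sum_le_sum fun j (_ : j ∈ Finset.univ) =>
      hT.two_le_missing_gadget (some j :: none :: none :: w)
    simp at this ⊢
    omega
  · exact fun c => h _ (List.suffix_cons _ _)
  · exact fun c => h _ List.suffix_rfl

theorem nine_mul_le_sum {r : ℕ → ℕ} {k : ℕ} (h8 : ∀ i < k, 8 ≤ r i)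
    (h9 : ∀ i, i + 1 < k → 9 ≤ r i ∨ 10 ≤ r (i + 1)) :
    9 * k ≤ ∑ i ∈ Finset.range k, r i + 1 := by
  have key : ∀ m, m + 1 ≤ k → 9 * (m + 1) ≤ ∑ i ∈ Finset.range (m + 1), r i ∨
      9 * (m + 1) ≤ ∑ i ∈ Finset.range (m + 1), r i + 1 ∧ r m < 9 := by
    intro m
    induction m with
    | zero =>
      intro hm
      have := h8 0 hm
      simp
      omega
    | succ m ih =>
      intro hm
      have ih := ih (by omega)
      have h8 := h8 (m + 1) hm
      have h9 := h9 m hm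
      rw [Finset.sum_range_succ]
      omega
  rcases k with _ | k
  · simp
  · have := key k le_rfl
    omega

/-- The central triangles. -/
def ctr (m : ℕ) : Word := List.replicate m none

theorem OuterplaneSet.nine_mul_le_missing {T : Set Vert} (hT : OuterplaneSet T) (k : ℕ) :
    9 * k ≤ ∑ i ∈ Finset.range k, missing T (block (ctr (2 * i))) + 1 := by
  refine nine_mul_le_sum (fun i _ => ?_) fun i _ => ?_
  · have := hT.eight_le_missing_block (ctr (2 * i))
    omega
  · refine (hT.eight_le_missing_block (ctr (2 * i))).imp_right fun h => ?_
    exact hT.ten_le_missing_block h.2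

end Counting

section FiniteGraph

/-- The triangles into which an octahedron is inserted. -/
def octWords (k : ℕ) : Set Word :=
  {w | (∃ m, m + 1 < 2 * k ∧ w = ctr m) ∨
    ∃ i < k, ∃ j, w = some j :: ctr (2 * i) ∨ w = none :: some j :: ctr (2 * i)}

theorem isTailClosed_octWords (k : ℕ) : IsTailClosed (octWords k) := by
  rintro τ w (⟨m, hm, h⟩ | ⟨i, hi, j, h | h⟩)
  · rcases m with _ | m
    · simp [ctr] at h
    · rw [ctr, List.replicate_succ, List.cons.injEq] at h
      exact Or.inl ⟨m, by omega, h.2⟩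
  · rw [List.cons.injEq] at h
    exact Or.inl ⟨2 * i, by omega, h.2⟩
  · rw [List.cons.injEq] at h
    exact Or.inr ⟨i, hi, j, Or.inl h.2⟩

/-- The positions within a block. -/
abbrev Slot := (Fin 3 ⊕ Fin 3) ⊕ Fin 3 × (Fin 3 ⊕ Fin 3)

/-- The block of a vertex and its position there. -/
def slotOf : Vert → ℕ × Slot
  | Sum.inl c => (0, Sum.inl (Sum.inl c))
  | Sum.inr (some j :: w, c) => (w.length / 2, Sum.inr (j, Sum.inl c))
  | Sum.inr (none :: some j :: w, c) => (w.length / 2, Sum.inr (j, Sum.inr c))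
  | Sum.inr (w, c) => ((w.length + 1) / 2,
      Sum.inl (if w.length % 2 = 0 then Sum.inr c else Sum.inl c))

theorem slotOf_ctr (m : ℕ) (c : Fin 3) : slotOf (Sum.inr (ctr m, c)) =
    ((m + 1) / 2, Sum.inl (if m % 2 = 0 then Sum.inr c else Sum.inl c)) := by
  rcases m with _ | _ | m
  · rfl
  · rfl
  · simp [ctr, List.replicate_succ, slotOf]

theorem slotOf_block (i : ℕ) (x : Slot) : slotOf (block (ctr (2 * i)) x) = (i, x) := by
  rcases x with (c | c) | ⟨j, c | c⟩
  · rcases i with _ | i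
    · rfl
    · change slotOf (Sum.inr (ctr (2 * i + 1), c)) = _
      rw [slotOf_ctr]
      simp [Nat.add_mod]
      omega
  · change slotOf (Sum.inr (ctr (2 * i), c)) = _
    rw [slotOf_ctr]
    simp
    omega
  · simp [block, gadget, slotOf, ctr]
  · simp [block, gadget, slotOf, ctr]

theorem block_mem_vertsOf {k i : ℕ} (hi : i < k) (x : Slot) :
    block (ctr (2 * i)) x ∈ vertsOf (octWords k) := by
  have h : ctr (2 * i) ∈ octWords k := Or.inl ⟨2 * i, by omega, rfl⟩
  rcases x with x | ⟨j, c | c⟩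
  · exact (isTailClosed_octWords k).oct_mem h x
  · exact Or.inr ⟨i, hi, j, Or.inl rfl⟩
  · exact Or.inr ⟨i, hi, j, Or.inr rfl⟩

theorem exists_block {k : ℕ} (hk : 0 < k) {v : Vert} (hv : v ∈ vertsOf (octWords k)) :
    ∃ i < k, ∃ x, block (ctr (2 * i)) x = v := by
  rcases v with c | ⟨w, c⟩
  · exact ⟨0, hk, Sum.inl (Sum.inl c), rfl⟩
  · rcases hv with ⟨m, hm, rfl⟩ | ⟨i, hi, j, rfl | rfl⟩
    · obtain ⟨i, rfl | rfl⟩ := m.even_or_odd'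
      · exact ⟨i, by omega, Sum.inl (Sum.inr c), rfl⟩
      · exact ⟨i + 1, by omega, Sum.inl (Sum.inl c), rfl⟩
    · exact ⟨i, hi, Sum.inr (j, Sum.inl c), rfl⟩
    · exact ⟨i, hi, Sum.inr (j, Sum.inr c), rfl⟩

/-- The vertices are partitioned into blocks. -/
noncomputable def blockEquiv {k : ℕ} (hk : 0 < k) : Fin k × Slot ≃ vertsOf (octWords k) :=
  Equiv.ofBijective
    (fun p => ⟨block (ctr (2 * p.1)) p.2, block_mem_vertsOf p.1.2 p.2⟩) ⟨by
      rintro ⟨i, x⟩ ⟨j, y⟩ h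
      have := congrArg (fun v => slotOf v.1) h
      simp only [slotOf_block, Prod.mk.injEq] at this
      exact Prod.ext (Fin.ext this.1) this.2, by
      rintro ⟨v, hv⟩
      obtain ⟨i, hi, x, rfl⟩ := exists_block hk hv
      exact ⟨(⟨i, hi⟩, x), rfl⟩⟩

theorem card_add_missing {k : ℕ} (hk : 0 < k) [Fintype (vertsOf (octWords k))]
    (S : Finset (vertsOf (octWords k))) :
    S.card + ∑ i ∈ Finset.range k, missing (Subtype.val '' (S : Set (vertsOf (octWords k))))
      (block (ctr (2 * i))) = 24 * k := by
  classical
  have hcard : S.card = ∑ i : Fin k, ∑ x : Slot, if blockEquiv hk (i, x) ∈ S then 1 else 0 := by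
    rw [← Fintype.sum_prod_type' fun i x => if blockEquiv hk (i, x) ∈ S then 1 else 0,
      (blockEquiv hk).sum_comp fun v => if v ∈ S then 1 else 0]
    simp
  rw [hcard, Finset.sum_range, ← Finset.sum_add_distrib]
  have : ∀ i : Fin k, (∑ x : Slot, if blockEquiv hk (i, x) ∈ S then 1 else 0) +
      missing (Subtype.val '' (S : Set (vertsOf (octWords k)))) (block (ctr (2 * i))) = 24 := by
    intro i
    rw [missing, ← Finset.sum_add_distrib]
    have hx : ∀ x : Slot, ((if blockEquiv hk (i, x) ∈ S then 1 else 0) +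
        if block (ctr (2 * i)) x ∈ Subtype.val '' (S : Set (vertsOf (octWords k)))
          then 0 else 1) = 1 := by
      intro x
      have hiff : block (ctr (2 * i)) x ∈ Subtype.val '' (S : Set (vertsOf (octWords k))) ↔
          blockEquiv hk (i, x) ∈ S := by
        rw [show block (ctr (2 * i)) x = (blockEquiv hk (i, x)).1 from rfl,
          Subtype.val_injective.mem_set_image, Finset.mem_coe]
      rw [if_congr hiff rfl rfl]
      split_ifs <;> rfl
    rw [Finset.sum_congr rfl fun x _ => hx x]
    rfl
  rw [Finset.sum_congr rfl fun i _ => this i]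
  simp [mul_comm]

theorem card_vertsOf {k : ℕ} (hk : 0 < k) [Fintype (vertsOf (octWords k))] :
    Fintype.card (vertsOf (octWords k)) = 24 * k := by
  rw [← Fintype.card_congr (blockEquiv hk)]
  simp [mul_comm]

end FiniteGraph

section OuterFace

/-- The vertices off `T` drawn in the outer face of the drawing of `T`. -/
def OuterVertex (T : Set Vert) (r : Vert) : Prop :=
  r ∉ T ∧ ¬ Bornology.IsBounded (connectedComponentIn (skeleton T)ᶜ (pt r))

theorem pt_mem_skeleton {T : Set Vert} {r : Vert} : pt r ∈ skeleton T ↔ r ∈ T := by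
  refine ⟨?_, fun h => Or.inl ⟨r, h, rfl⟩⟩
  rintro (⟨s, hs, h⟩ | ⟨u, hu, v, hv, h, hz⟩)
  · exact pt_injective h ▸ hs
  · rcases pt_mem_segment h hz with rfl | rfl
    exacts [hu, hv]

/-- An edge with an end off `T` can meet the drawing of `T` only in its other end. -/
theorem eq_of_mem_segment_of_mem_skeleton {T : Set Vert} {r s : Vert} (hr : r ∉ T)
    (h : nested.Adj r s) {z : ℝ × ℝ} (hz : z ∈ segment ℝ (pt r) (pt s)) (hzT : z ∈ skeleton T) :
    z = pt s := by
  have key : ∀ t ∈ T, z = pt t → z = pt s := by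
    rintro t ht rfl
    rcases pt_mem_segment h hz with rfl | rfl
    exacts [(hr ht).elim, rfl]
  rcases hzT with ⟨t, ht, rfl⟩ | ⟨u, hu, v, hv, huv, hz'⟩
  · exact key t ht rfl
  · have hne : s(r, s) ≠ s(u, v) := by
      intro he
      have : r ∈ s(u, v) := he ▸ Sym2.mem_mk_left r s
      rcases Sym2.mem_iff.1 this with rfl | rfl
      exacts [hr hu, hr hv]
    rcases (segment_pt_inter h huv hne hz hz').2 with h' | h'
    exacts [key u hu h', key v hv h']

theorem OuterVertex.of_adj {T : Set Vert} {r s : Vert} (hr : OuterVertex T r)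
    (h : nested.Adj r s) (hs : s ∉ T) : OuterVertex T s := by
  refine ⟨hs, ?_⟩
  have hsub : segment ℝ (pt r) (pt s) ⊆ (skeleton T)ᶜ := fun z hz hzT =>
    hs (pt_mem_skeleton.1 (eq_of_mem_segment_of_mem_skeleton hr.1 h hz hzT ▸ hzT))
  have := (convex_segment (pt r) (pt s)).isPreconnected.subset_connectedComponentIn
    (left_mem_segment ℝ _ _) hsub (right_mem_segment ℝ _ _)
  rw [← connectedComponentIn_eq this]
  exact hr.2

theorem OuterVertex.mem_closure_of_adj {T : Set Vert} {r s : Vert} (hr : OuterVertex T r)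
    (h : nested.Adj r s) : pt s ∈ closure {p | p ∉ skeleton T ∧
      ¬ Bornology.IsBounded (connectedComponentIn (skeleton T)ᶜ p)} := by
  have hne : pt r ≠ pt s := pt_injective.ne h.ne
  let X : Set (ℝ × ℝ) := segment ℝ (pt r) (pt s) \ {pt s}
  have hoX : openSegment ℝ (pt r) (pt s) ⊆ X := fun z hz =>
    ⟨openSegment_subset_segment ℝ _ _ hz, by
      rintro rfl
      exact hne (right_mem_openSegment_iff.1 hz)⟩
  have hX : IsPreconnected X := (convex_openSegment (pt r) (pt s)).isPreconnected.subset_closure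
    hoX (Set.sdiff_subset.trans segment_subset_closure_openSegment)
  have hXT : X ⊆ (skeleton T)ᶜ := fun z hz hzT =>
    hz.2 (eq_of_mem_segment_of_mem_skeleton hr.1 h hz.1 hzT)
  have hrX : pt r ∈ X := ⟨left_mem_segment ℝ _ _, hne⟩
  have hsub := hX.subset_connectedComponentIn hrX hXT
  refine closure_mono (fun z hz => ?_)
    (segment_subset_closure_openSegment (right_mem_segment ℝ (pt r) (pt s)))
  refine ⟨hXT (hoX hz), ?_⟩
  rw [← connectedComponentIn_eq (hsub (hoX hz))]
  exact hr.2

theorem pos_nonneg (s : Vert) (i : Fin 3) : 0 ≤ pos s i := by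
  rcases s with c | ⟨w, c⟩
  · exact octPt_nonneg (Sum.inl c) i
  · exact triMap_nonneg (octPt_nonneg _) i

theorem skeleton_subset (T : Set Vert) : skeleton T ⊆ Set.Ici 0 := by
  have hpt : ∀ s, pt s ∈ Set.Ici (0 : ℝ × ℝ) := fun s => ⟨pos_nonneg s 1, pos_nonneg s 2⟩
  rintro z (⟨t, -, rfl⟩ | ⟨u, -, v, -, -, hz⟩)
  · exact hpt t
  · exact (convex_Ici (𝕜 := ℝ) (0 : ℝ × ℝ)).segment_subset (hpt u) (hpt v) hz

theorem outerVertex_zero {T : Set Vert} (h : Sum.inl 0 ∉ T) : OuterVertex T (Sum.inl 0) := by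
  refine ⟨h, fun hb => ?_⟩
  have h0 : pt (Sum.inl 0) = 0 := by simp [pt, pos, octPt]
  rw [h0] at hb
  have hsub : Set.Iic 0 ⊆ (skeleton T)ᶜ := by
    intro z hz hzT
    have hz0 : z = 0 := le_antisymm hz (skeleton_subset T hzT)
    rw [hz0, ← h0, pt_mem_skeleton] at hzT
    exact h hzT
  have hb' := hb.subset ((convex_Iic (𝕜 := ℝ)
    (0 : ℝ × ℝ)).isPreconnected.subset_connectedComponentIn Set.self_mem_Iic hsub)
  obtain ⟨C, hC⟩ := hb'.exists_norm_le
  have h1 := hC (-(|C| + 1), 0) ⟨by dsimp; linarith [abs_nonneg C], le_rfl⟩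
  have h2 : |C| + 1 ≤ ‖((-(|C| + 1), 0) : ℝ × ℝ)‖ := by
    refine le_trans ?_ (norm_fst_le _)
    rw [norm_neg]
    exact le_abs_self _
  linarith [le_abs_self C]

end OuterFace

section Witness

/-- The positions of the `i`-th of `k` blocks that are dropped in the extremal example. -/
def dropped (k i : ℕ) : Slot → Bool
  | Sum.inl (Sum.inl c) => c ≠ 2
  | Sum.inl (Sum.inr c) => c = 0 ∧ i + 1 < k
  | Sum.inr (_, Sum.inl c) => c = 0
  | Sum.inr (_, Sum.inr c) => c = 0

/-- The vertices kept in the extremal example. -/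
def kept (k : ℕ) : Set Vert :=
  {v | v ∈ vertsOf (octWords k) ∧ dropped k (slotOf v).1 (slotOf v).2 = false}

theorem block_mem_kept {k i : ℕ} (hi : i < k) (x : Slot) :
    block (ctr (2 * i)) x ∈ kept k ↔ dropped k i x = false := by
  simp only [kept, Set.mem_ofPred_eq, slotOf_block, block_mem_vertsOf hi, true_and]

theorem missing_kept {k i : ℕ} (hi : i < k) :
    missing (kept k) (block (ctr (2 * i))) = if i + 1 < k then 9 else 8 := by
  have : missing (kept k) (block (ctr (2 * i))) = ∑ x, (dropped k i x).toNat := by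
    refine Finset.sum_congr rfl fun x _ => ?_
    by_cases h : dropped k i x = false <;> simp [block_mem_kept hi, h]
  rw [this]
  split_ifs with h <;>
    simp [dropped, h, Fintype.sum_sum_type, Fintype.sum_prod_type, Fin.sum_univ_three]

theorem sum_missing_kept (k : ℕ) :
    ∑ i ∈ Finset.range (k + 1), missing (kept (k + 1)) (block (ctr (2 * i))) = 9 * k + 8 := by
  rw [Finset.sum_congr rfl fun i hi => missing_kept (Finset.mem_range.1 hi),
    Finset.sum_range_succ, Finset.sum_congr rfl fun i hi => if_pos
      (Nat.succ_lt_succ (Finset.mem_range.1 hi))]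
  simp [mul_comm]

theorem outerVertex_of_dropped {k i : ℕ} (hi : i < k) {x : Slot} (hx : dropped k i x = true) :
    OuterVertex (kept k) (block (ctr (2 * i)) x) := by
  have hnot : ∀ {i : ℕ}, i < k → ∀ {x : Slot}, dropped k i x = true →
      block (ctr (2 * i)) x ∉ kept k := by
    intro i hi x hx h
    rw [block_mem_kept hi, hx] at h
    cases h
  have hB : ∀ {i}, i + 1 < k → OuterVertex (kept k) (face (ctr (2 * i)) 0) →
      OuterVertex (kept k) (Sum.inr (ctr (2 * i), 0)) := fun {i} hi h =>
    h.of_adj (nested_adj_spoke (by decide)).symm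
      (hnot (i := i) (by omega) (x := Sum.inl (Sum.inr 0)) (by simp [dropped, hi]))
  have hA0 : OuterVertex (kept k) (face (ctr (2 * i)) 0) := by
    clear hx
    induction i with
    | zero => exact outerVertex_zero (hnot hi (x := Sum.inl (Sum.inl 0)) rfl)
    | succ i ih =>
      exact (hB hi (ih (by omega))).of_adj
        (nested_adj_spoke (w := ctr (2 * i + 1)) (a := 0) (b := 0) (by decide)).symm
        (hnot hi (x := Sum.inl (Sum.inl 0)) rfl)
  have hA1 : OuterVertex (kept k) (face (ctr (2 * i)) 1) :=
    hA0.of_adj (nested_adj_face (by decide)) (hnot hi (x := Sum.inl (Sum.inl 1)) rfl)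
  have hP : ∀ j, OuterVertex (kept k) (Sum.inr (some j :: ctr (2 * i), 0)) := by
    intro j
    have hj := hnot hi (x := Sum.inr (j, Sum.inl 0)) rfl
    have h0 : nested.Adj (face (ctr (2 * i)) j) (Sum.inr (some j :: ctr (2 * i), 0)) :=
      (nested_adj_spoke (w := some j :: ctr (2 * i)) (a := 0) (b := 0) (by decide)).symm
    have h1 : nested.Adj (face (ctr (2 * i)) (j + 1)) (Sum.inr (some j :: ctr (2 * i), 0)) :=
      (nested_adj_spoke (w := some j :: ctr (2 * i)) (a := 0) (b := 1) (by decide)).symm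
    fin_cases j
    exacts [hA0.of_adj h0 hj, hA1.of_adj h0 hj, hA0.of_adj h1 hj]
  rcases x with (c | c) | ⟨j, c | c⟩
  · fin_cases c
    exacts [hA0, hA1, by simp [dropped] at hx]
  · simp only [dropped, decide_eq_true_eq] at hx
    obtain ⟨rfl, hi'⟩ := hx
    exact hB hi' hA0
  · simp only [dropped, decide_eq_true_eq] at hx
    subst hx
    exact hP j
  · simp only [dropped, decide_eq_true_eq] at hx
    subst hx
    exact (hP j).of_adj (nested_adj_spoke (w := none :: some j :: ctr (2 * i)) (a := 0) (b := 0)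
      (by decide)).symm (hnot hi (x := Sum.inr (j, Sum.inr 0)) rfl)

theorem outerplaneSet_kept {k : ℕ} (hk : 0 < k) : OuterplaneSet (kept k) := by
  intro v hv
  obtain ⟨i, hi, x, rfl⟩ := exists_block hk hv.1
  rw [block_mem_kept hi] at hv
  have hA0 := outerVertex_of_dropped hi (x := Sum.inl (Sum.inl 0)) rfl
  have hA1 := outerVertex_of_dropped hi (x := Sum.inl (Sum.inl 1)) rfl
  rcases x with (c | c) | ⟨j, c | c⟩
  · refine hA0.mem_closure_of_adj (nested_adj_face ?_)
    rintro rfl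
    simp [dropped] at hv
  · fin_cases c
    · exact hA0.mem_closure_of_adj (nested_adj_spoke (by decide)).symm
    · exact hA1.mem_closure_of_adj (nested_adj_spoke (by decide)).symm
    · exact hA0.mem_closure_of_adj (nested_adj_spoke (by decide)).symm
  · refine (outerVertex_of_dropped hi (x := Sum.inr (j, Sum.inl 0)) rfl).mem_closure_of_adj
      (nested_adj_inr ?_)
    rintro rfl
    simp [dropped] at hv
  · refine (outerVertex_of_dropped hi (x := Sum.inr (j, Sum.inr 0)) rfl).mem_closure_of_adj
      (nested_adj_inr ?_)
    rintro rfl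
    simp [dropped] at hv

end Witness

/-- For every `k ≥ 2` there is a plane triangulation of order
`n = 24k` whose maximum induced outerplane subgraph (in the inherited embedding) has
order exactly `5n/8 + 1 = 15k + 1`; in particular `s_{o'}(G) < 2n/3`. -/
theorem stmt17 (k : ℕ) (hk : 2 ≤ k) :
    ∃ (V : Type) (inst : Fintype V) (G : SimpleGraph V) (E : PlaneEmbedding G),
      IsPlaneTriangulation G ∧
      @Fintype.card V inst = 24 * k ∧
      @sO' V inst G E = 15 * k + 1 ∧
      3 * @sO' V inst G E < 2 * @Fintype.card V inst := by
  classical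
  have hk0 : 0 < k := by omega
  let inst : Fintype (vertsOf (octWords k)) := Fintype.ofEquiv _ (blockEquiv hk0)
  have hmax : sO' (drawing (vertsOf (octWords k))) = 15 * k + 1 := by
    let S : Finset (vertsOf (octWords k)) := {v | v.1 ∈ kept k}
    have hS : Subtype.val '' (S : Set (vertsOf (octWords k))) = kept k := by
      ext v
      simp only [S, Finset.coe_filter, Finset.mem_univ, true_and, Set.mem_image, Set.mem_ofPred_eq]
      exact ⟨fun ⟨u, hu, h⟩ => h ▸ hu, fun hv => ⟨⟨v, hv.1⟩, hv, rfl⟩⟩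
    refine IsGreatest.csSup_eq ⟨⟨S, ?_, ?_⟩, ?_⟩
    · rw [drawing_outerplaneOn, hS]
      exact outerplaneSet_kept hk0
    · have h := card_add_missing hk0 S
      obtain ⟨m, rfl⟩ : ∃ m, k = m + 1 := ⟨k - 1, by omega⟩
      rw [hS, sum_missing_kept] at h
      omega
    · rintro _ ⟨S, hS, rfl⟩
      rw [drawing_outerplaneOn] at hS
      have h1 := hS.nine_mul_le_missing k
      have h2 := card_add_missing hk0 S
      omega
  refine ⟨vertsOf (octWords k), inst, nested.induce _, drawing _, ⟨⟨drawing _⟩, fun u v huv h =>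
    nested_not_isPlanar_sup (isTailClosed_octWords k) huv h⟩, card_vertsOf hk0, hmax, ?_⟩
  rw [hmax, card_vertsOf hk0]
  omega
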